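/- arXiv:1902.03213 — 2 statements merged into one kernel-verified Lean document; each statement's English description precedes it below -/
import Mathlib

section
/- Let k > r > 2, t ≥ 1. If G is a K_k-free graph on n vertices with a blue-red edge-coloring, then N(K_r, G_blue) + t·|E(G_red)| + (t−1)·(C(n,2) − |E(G)|) ≤ (t−1)·C(n,2) + max{ ex(n, K_r, K_k) − (t−1)·ex(n, K_k), ex(n, K_k) }. -/
open Finset

/-- `H` contains a `t`-heavy copy of the graph `F`: an injective placement of `V(F)`
such that every edge of `F` is contained in at least `t` hyperedges of `H`. -/
def HasHeavyCopy {V α : Type*} [DecidableEq V] (H : Finset (Finset V))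
    (F : SimpleGraph α) (t : ℕ) : Prop :=
  ∃ i : α ↪ V, ∀ x y, F.Adj x y →
    t ≤ (H.filter (fun A => i x ∈ A ∧ i y ∈ A)).card

/-- `H` contains a `t`-wise Berge copy of the graph `F`: an injective placement of `V(F)`
together with `t` hyperedges assigned to each edge of `F`, pairwise disjoint over distinct
edges, each containing both endpoints of its edge. -/
def HasBergeCopy {V α : Type*} (H : Finset (Finset V))
    (F : SimpleGraph α) (t : ℕ) : Prop :=
  ∃ (i : α ↪ V) (h : Sym2 α → Finset (Finset V)),
    (∀ e ∈ F.edgeSet, h e ⊆ H ∧ (h e).card = t ∧ ∀ A ∈ h e, ∀ x ∈ e, i x ∈ A) ∧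
    ∀ e ∈ F.edgeSet, ∀ e' ∈ F.edgeSet, e ≠ e' → Disjoint (h e) (h e')

/-- The Turán number of `t`-heavy copies of `F` for `r`-uniform hypergraphs on `n` vertices. -/
noncomputable def exHeavy {α : Type*} (n r t : ℕ) (F : SimpleGraph α) : ℕ :=
  sSup {m | ∃ H : Finset (Finset (Fin n)), (∀ A ∈ H, A.card = r) ∧
    ¬ HasHeavyCopy H F t ∧ H.card = m}

/-- The Turán number of `t`-wise Berge copies of `F` for `r`-uniform hypergraphs on `n` vertices. -/
noncomputable def exBerge {α : Type*} (n r t : ℕ) (F : SimpleGraph α) : ℕ :=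
  sSup {m | ∃ H : Finset (Finset (Fin n)), (∀ A ∈ H, A.card = r) ∧
    ¬ HasBergeCopy H F t ∧ H.card = m}

/-- `G` contains a copy of `F` as a subgraph. -/
def GraphContains {α β : Type*} (F : SimpleGraph α) (G : SimpleGraph β) : Prop :=
  ∃ f : α ↪ β, ∀ x y, F.Adj x y → G.Adj (f x) (f y)

/-- The number of `r`-cliques of `G`. -/
noncomputable def cliqueCount {β : Type*} [Fintype β] [DecidableEq β]
    (r : ℕ) (G : SimpleGraph β) : ℕ :=
  letI := Classical.decRel G.Adj
  (G.cliqueFinset r).card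

/-- The number of edges of `G`. -/
noncomputable def edgeCount {β : Type*} [Fintype β] [DecidableEq β] (G : SimpleGraph β) : ℕ :=
  letI := Classical.decRel G.Adj
  G.edgeFinset.card

/-- The generalized Turán number `ex(n, K_r, F)`. -/
noncomputable def exClique {α : Type*} (n r : ℕ) (F : SimpleGraph α) : ℕ :=
  sSup {m | ∃ G : SimpleGraph (Fin n), ¬ GraphContains F G ∧ cliqueCount r G = m}

/-- The Turán number `ex(n, F)`. -/
noncomputable def exTuran {α : Type*} (n : ℕ) (F : SimpleGraph α) : ℕ :=
  sSup {m | ∃ G : SimpleGraph (Fin n), ¬ GraphContains F G ∧ edgeCount G = m}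

namespace SimpleGraph

lemma isNClique_replaceVertex_iff {V : Type*} [DecidableEq V] {G : SimpleGraph V} {m : ℕ}
    {u v : V} {s : Finset V} (hu : u ∉ s) :
    (G.replaceVertex v u).IsNClique m s ↔ G.IsNClique m s := by
  simp only [isNClique_iff, isClique_iff, Set.Pairwise]
  refine and_congr_left fun _ ↦ forall₂_congr fun a ha ↦ forall₂_congr fun b hb ↦ ?_
  rw [adj_replaceVertex_iff_of_ne]
  exacts [fun h ↦ hu (h ▸ ha), fun h ↦ hu (h ▸ hb)]

section CliqueCounting

variable {V : Type*} [Fintype V]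

open Classical in
/-- The number of `m`-cliques of `G` satisfying `P`. -/
noncomputable def numCliques (m : ℕ) (G : SimpleGraph V) (P : Finset V → Prop) : ℕ :=
  #{s : Finset V | G.IsNClique m s ∧ P s}

variable {G G' : SimpleGraph V} {P P' : Finset V → Prop} {m : ℕ} {u v x y : V}

lemma numCliques_congr
    (h : ∀ s, (G.IsNClique m s ∧ P s) ↔ (G'.IsNClique m s ∧ P' s)) :
    numCliques m G P = numCliques m G' P' := by
  classical
  exact congrArg card (filter_congr fun s _ ↦ h s)

lemma numCliques_and_add_and_not (m : ℕ) (G : SimpleGraph V) (P Q : Finset V → Prop) :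
    numCliques m G (fun s ↦ P s ∧ Q s) + numCliques m G (fun s ↦ P s ∧ ¬ Q s) =
      numCliques m G P := by
  classical
  simp only [numCliques, ← and_assoc]
  simp only [← filter_filter _ Q, ← filter_filter _ (fun s ↦ ¬ Q s)]
  exact card_filter_add_card_filter_not _

lemma numCliques_add_not (m : ℕ) (G : SimpleGraph V) (Q : Finset V → Prop) :
    numCliques m G Q + numCliques m G (fun s ↦ ¬ Q s) = numCliques m G (fun _ ↦ True) := by
  simpa using numCliques_and_add_and_not m G (fun _ ↦ True) Q

/-- Exchanging the vertex `x` for `y` in cliques. -/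
lemma numCliques_le_of_exchange [DecidableEq V] (x y : V)
    (h : ∀ s, G.IsNClique m s → P s → x ∈ s ∧ y ∉ s ∧ G'.IsClique (s.erase x : Finset V) ∧
      (∀ z ∈ s, z ≠ x → G'.Adj y z) ∧ P' (insert y (s.erase x))) :
    numCliques m G P ≤ numCliques m G' P' := by
  classical
  refine card_le_card_of_injOn (fun s ↦ insert y (s.erase x)) ?_ ?_
  · intro s hs
    simp only [coe_filter, mem_univ, true_and, Set.mem_ofPred_eq] at hs ⊢
    obtain ⟨hx, hy, hc, ha, hP⟩ := h s hs.1 hs.2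
    refine ⟨⟨?_, ?_⟩, hP⟩
    · rw [coe_insert, isClique_insert]
      exact ⟨hc, fun z hz _ ↦ ha z (mem_of_mem_erase hz) (ne_of_mem_erase hz)⟩
    · rw [card_insert_of_notMem (fun hh ↦ hy (mem_of_mem_erase hh)), card_erase_add_one hx,
        hs.1.card_eq]
  · intro s hs s' hs' heq
    simp only [coe_filter, mem_univ, true_and, Set.mem_ofPred_eq] at hs hs' heq
    obtain ⟨hx, hy, -⟩ := h s hs.1 hs.2
    obtain ⟨hx', hy', -⟩ := h s' hs'.1 hs'.2
    have := congrArg (fun q ↦ insert x (q.erase y)) heq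
    simpa [erase_insert (fun hh ↦ hy (mem_of_mem_erase hh)),
      erase_insert (fun hh ↦ hy' (mem_of_mem_erase hh)), insert_erase hx, insert_erase hx']
      using this

lemma numCliques_eq_zero (h : ∀ s, G.IsNClique m s → ¬ P s) : numCliques m G P = 0 := by
  simpa [numCliques, filter_eq_empty_iff] using h

lemma numCliques_of_not_adj (hne : u ≠ v) (h : ¬ G.Adj u v) :
    numCliques m G (fun s ↦ u ∈ s ∧ v ∈ s) = 0 := by
  exact numCliques_eq_zero fun s hs ⟨hu, hv⟩ ↦ h (hs.isClique hu hv hne)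

lemma numCliques_two_of_adj (h : G.Adj u v) :
    numCliques 2 G (fun s ↦ u ∈ s ∧ v ∈ s) = 1 := by
  classical
  rw [numCliques, card_eq_one]
  refine ⟨{u, v}, ?_⟩
  ext s
  simp only [mem_filter, mem_univ, true_and, mem_singleton]
  constructor
  · rintro ⟨hs, hu, hv⟩
    refine (eq_of_subset_of_card_le (by simp [insert_subset_iff, hu, hv]) ?_).symm
    rw [hs.card_eq, card_pair h.ne]
  · rintro rfl
    exact ⟨⟨by simp [isClique_insert, h], card_pair h.ne⟩, by simp⟩

lemma numCliques_deleteEdges_add (hne : u ≠ v) :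
    numCliques m (G.deleteEdges {s(u, v)}) (fun _ ↦ True) +
      numCliques m G (fun s ↦ u ∈ s ∧ v ∈ s) = numCliques m G (fun _ ↦ True) := by
  rw [← numCliques_add_not m G (fun s ↦ u ∈ s ∧ v ∈ s), add_comm]
  congr 1
  refine numCliques_congr fun s ↦ ?_
  simp only [isNClique_iff, and_true]
  constructor
  · rintro ⟨hs, hc⟩
    refine ⟨⟨hs.mono (deleteEdges_le _), hc⟩, fun ⟨hu, hv⟩ ↦ ?_⟩
    have := hs hu hv hne
    simp at this
  · rintro ⟨⟨hs, hc⟩, hn⟩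
    refine ⟨fun a ha b hb hab ↦ ?_, hc⟩
    rw [deleteEdges_adj]
    refine ⟨hs ha hb hab, fun h ↦ hn ?_⟩
    simp only [Set.mem_singleton_iff, Sym2.eq_iff] at h
    rcases h with ⟨rfl, rfl⟩ | ⟨rfl, rfl⟩
    exacts [⟨ha, hb⟩, ⟨hb, ha⟩]

lemma numCliques_sup_edge (hne : u ≠ v) (h : ¬ G.Adj u v) :
    numCliques m (G ⊔ edge u v) (fun _ ↦ True) = numCliques m G (fun _ ↦ True) +
      numCliques m (G ⊔ edge u v) (fun s ↦ u ∈ s ∧ v ∈ s) := by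
  rw [← numCliques_deleteEdges_add (G := G ⊔ edge u v) hne]
  congr 2
  ext a b
  simp only [deleteEdges_adj, sup_adj, adj_edge, Set.mem_singleton_iff]
  constructor
  · rintro ⟨h1 | h1, h2⟩
    exacts [h1, (h2 h1.1.symm).elim]
  · refine fun hab ↦ ⟨.inl hab, fun heq ↦ h ?_⟩
    rwa [← mem_edgeSet, ← heq, mem_edgeSet]

variable [DecidableEq V]

lemma numCliques_replaceVertex (hne : v ≠ u) :
    numCliques m (G.replaceVertex v u) (fun _ ↦ True) + numCliques m G (fun s ↦ u ∈ s) +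
      numCliques m G (fun s ↦ v ∈ s ∧ u ∈ s) =
    numCliques m G (fun _ ↦ True) + numCliques m G (fun s ↦ v ∈ s) := by
  have h1 : numCliques m (G.replaceVertex v u) (fun s ↦ u ∉ s) =
      numCliques m G (fun s ↦ u ∉ s) :=
    numCliques_congr fun s ↦ and_congr_left fun hu ↦ isNClique_replaceVertex_iff hu
  have h2 : numCliques m (G.replaceVertex v u) (fun s ↦ u ∈ s) =
      numCliques m G (fun s ↦ v ∈ s ∧ u ∉ s) := by
    apply le_antisymm
    · refine numCliques_le_of_exchange u v fun s hs hu ↦ ?_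
      have hv : v ∉ s := fun hv ↦ not_adj_replaceVertex_same G v u (hs.isClique hv hu hne)
      refine ⟨hu, hv, fun a ha b hb hab ↦ ?_, fun z hz hzu ↦ ?_, mem_insert_self .., ?_⟩
      · simp only [coe_erase, Set.mem_sdiff, mem_coe, Set.mem_singleton_iff] at ha hb
        exact (adj_replaceVertex_iff_of_ne _ _ ha.2 hb.2).1 (hs.isClique ha.1 hb.1 hab)
      · exact (adj_replaceVertex_iff_of_ne_right _ _ hzu).1 (hs.isClique hu hz hzu.symm)
      · simp [hne.symm]
    · refine numCliques_le_of_exchange v u fun s hs ⟨hv, hu⟩ ↦ ?_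
      refine ⟨hv, hu, fun a ha b hb hab ↦ ?_, fun z hz hzv ↦ ?_, mem_insert_self ..⟩
      · simp only [coe_erase, Set.mem_sdiff, mem_coe, Set.mem_singleton_iff] at ha hb
        exact (adj_replaceVertex_iff_of_ne _ _ (ne_of_mem_of_not_mem ha.1 hu)
          (ne_of_mem_of_not_mem hb.1 hu)).2 (hs.isClique ha.1 hb.1 hab)
      · exact (adj_replaceVertex_iff_of_ne_right _ _ (ne_of_mem_of_not_mem hz hu)).2
          (hs.isClique hv hz hzv.symm)
  have h3 := numCliques_add_not m (G.replaceVertex v u) (fun s ↦ u ∈ s)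
  have h4 := numCliques_add_not m G (fun s ↦ u ∈ s)
  have h5 := numCliques_and_add_and_not m G (fun s ↦ v ∈ s) (fun s ↦ u ∈ s)
  lia

lemma numCliques_mem_replaceVertex (hx : x ≠ u) (h : ¬ G.Adj v x) :
    numCliques m (G.replaceVertex v u) (fun s ↦ x ∈ s) +
      numCliques m G (fun s ↦ x ∈ s ∧ u ∈ s) = numCliques m G (fun s ↦ x ∈ s) := by
  rw [← numCliques_and_add_and_not m G (fun s ↦ x ∈ s) (fun s ↦ u ∈ s),
    ← numCliques_and_add_and_not m (G.replaceVertex v u) (fun s ↦ x ∈ s) (fun s ↦ u ∈ s),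
    numCliques_of_not_adj hx (fun hh ↦ h ?_), zero_add, add_comm]
  · congr 1
    refine numCliques_congr fun s ↦ and_congr_left fun hu ↦ isNClique_replaceVertex_iff hu.2
  · exact (adj_replaceVertex_iff_of_ne_right _ _ hx).1 hh.symm

lemma numCliques_le_sup_edge (hE : Equivalence (¬ G.Adj · ·)) (hne : x ≠ y)
    (hxy : ¬ G.Adj x y) (hxv : G.Adj x v) :
    numCliques m G (fun s ↦ x ∈ s ∧ v ∈ s) ≤
      numCliques m (G ⊔ edge x y) (fun s ↦ x ∈ s ∧ y ∈ s) := by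
  refine numCliques_le_of_exchange v y fun s hs ⟨hx, hv⟩ ↦ ?_
  refine ⟨hv, fun hy ↦ hxy (hs.isClique hx hy hne), ?_, fun z hz hzv ↦ ?_,
    by simp [hx, hxv.ne], mem_insert_self ..⟩
  · exact (hs.isClique.subset (by simp)).mono le_sup_left
  · by_cases hzx : z = x
    · subst hzx
      exact .inr (by simp [adj_edge, hne.symm, Sym2.eq_swap])
    · refine .inl ?_
      by_contra hyz
      exact hE.trans hxy hyz (hs.isClique hx hz (Ne.symm hzx))

lemma numCliques_twin_le (hE : Equivalence (¬ G.Adj · ·)) (huv : G.Adj u v)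
    (hvx : ¬ G.Adj v x) :
    numCliques m G (fun s ↦ u ∈ s ∧ v ∈ s) ≤ numCliques m G (fun s ↦ u ∈ s ∧ x ∈ s) := by
  rcases eq_or_ne v x with rfl | hne
  · rfl
  refine numCliques_le_of_exchange v x fun s hs ⟨hu, hv⟩ ↦ ?_
  refine ⟨hv, fun hx ↦ hvx (hs.isClique hv hx hne), hs.isClique.subset (by simp),
    fun z hz hzv ↦ ?_, by simp [hu, huv.ne], mem_insert_self ..⟩
  by_contra hxz
  exact hE.trans hvx hxz (hs.isClique hv hz (Ne.symm hzv))

lemma numCliques_twin (hE : Equivalence (¬ G.Adj · ·)) (huv : G.Adj u v)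
    (hvx : ¬ G.Adj v x) :
    numCliques m G (fun s ↦ u ∈ s ∧ x ∈ s) = numCliques m G (fun s ↦ u ∈ s ∧ v ∈ s) := by
  refine le_antisymm (numCliques_twin_le hE ?_ (hE.symm hvx)) (numCliques_twin_le hE huv hvx)
  by_contra h
  exact hE.trans h (hE.symm hvx) huv

open Classical in
lemma numCliques_mem_eq (hE : Equivalence (¬ G.Adj · ·)) (huv : G.Adj u v) :
    numCliques m G (fun s ↦ u ∈ s) = numCliques m G (fun s ↦ u ∈ s ∧ ∀ z ∈ s, G.Adj v z) +
      #{x | ¬ G.Adj v x} * numCliques m G (fun s ↦ u ∈ s ∧ v ∈ s) := by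
  rw [← numCliques_and_add_and_not m G (fun s ↦ u ∈ s) (fun s ↦ ∀ z ∈ s, G.Adj v z)]
  congr 1
  rw [← smul_eq_mul, ← sum_const, ← sum_congr rfl (fun x hx ↦
    numCliques_twin hE huv (by simpa using hx))]
  simp only [numCliques]
  rw [← card_biUnion]
  · congr 1
    ext s
    simp only [mem_filter, mem_univ, true_and, mem_biUnion, not_forall]
    grind
  · intro a ha b hb hab
    refine Finset.disjoint_left.2 ?_
    simp only [mem_filter, mem_univ, true_and]
    simp only [coe_filter, mem_univ, true_and, Set.mem_ofPred_eq] at ha hb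
    rintro s ⟨hs, -, has⟩ ⟨-, -, hbs⟩
    exact hE.trans (hE.symm ha) hb (hs.isClique has hbs hab)

lemma numCliques_avoid_le (huv : G.Adj u v) :
    numCliques m G (fun s ↦ u ∈ s ∧ ∀ z ∈ s, G.Adj v z) ≤
      numCliques m G (fun s ↦ v ∈ s ∧ ∀ z ∈ s, G.Adj u z) := by
  refine numCliques_le_of_exchange u v fun s hs ⟨hu, hv⟩ ↦ ?_
  refine ⟨hu, fun h ↦ G.irrefl (hv v h), hs.isClique.subset (by simp), fun z hz _ ↦ hv z hz,
    mem_insert_self .., fun z hz ↦ ?_⟩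
  rcases mem_insert.1 hz with rfl | hz
  · exact huv
  · exact hs.isClique hu (mem_of_mem_erase hz) (ne_of_mem_erase hz).symm

open Classical in
lemma numCliques_mem_add (hE : Equivalence (¬ G.Adj · ·)) (huv : G.Adj u v) :
    numCliques m G (fun s ↦ u ∈ s) +
        #{x | ¬ G.Adj u x} * numCliques m G (fun s ↦ u ∈ s ∧ v ∈ s) =
      numCliques m G (fun s ↦ v ∈ s) +
        #{x | ¬ G.Adj v x} * numCliques m G (fun s ↦ u ∈ s ∧ v ∈ s) := by
  rw [numCliques_mem_eq hE huv, numCliques_mem_eq hE huv.symm,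
    le_antisymm (numCliques_avoid_le huv) (numCliques_avoid_le huv.symm)]
  simp only [and_comm (a := v ∈ _) (b := u ∈ _)]
  ring

end CliqueCounting

section Turan

variable {V : Type*} [Fintype V] [DecidableEq V] {G : SimpleGraph V} {q : ℕ}

open Classical in
/-- A balanced complete multipartite graph with the right number of parts is a Turán graph. -/
theorem nonempty_iso_turanGraph_of_equivalence (hE : Equivalence (¬ G.Adj · ·))
    (hbal : ∀ u v, G.Adj u v → #{x | ¬ G.Adj u x} ≤ #{x | ¬ G.Adj v x} + 1)
    (hcf : G.CliqueFree (q + 1))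
    (hfull : ∀ x y, x ≠ y → ¬ G.Adj x y → ¬ G.CliqueFree q) :
    Nonempty (G ≃g turanGraph (Fintype.card V) q) := by
  let S : Setoid V := ⟨_, hE⟩
  let fp : Finpartition (univ : Finset V) := Finpartition.ofSetoid S
  have hpart : ∀ s, fp.part s = ({x | ¬ G.Adj s x} : Finset V) := by
    intro s
    ext x
    rw [mem_filter, Finpartition.mem_part_ofSetoid_iff_rel]
    exact (and_iff_right (mem_univ x)).symm
  have hadj : ∀ s t, ¬ G.Adj s t ↔ fp.part s = fp.part t := by
    intro s t
    rw [eq_comm, ← fp.mem_part_iff_part_eq_part (mem_univ t) (mem_univ s), hpart]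
    simp
  have heq : fp.IsEquipartition := by
    by_contra hn
    rw [Finpartition.not_isEquipartition] at hn
    obtain ⟨large, hl, small, hs, ineq⟩ := hn
    obtain ⟨w, hw⟩ := fp.nonempty_of_mem_parts hl
    obtain ⟨v, hv⟩ := fp.nonempty_of_mem_parts hs
    have large_eq := fp.part_eq_of_mem hl hw
    have small_eq := fp.part_eq_of_mem hs hv
    have ha : G.Adj w v := by
      by_contra hn
      rw [hadj, small_eq, large_eq] at hn
      rw [hn] at ineq; lia
    have := hbal w v ha
    rw [← hpart, ← hpart, large_eq, small_eq] at this
    lia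
  have hle : #fp.parts ≤ q := by
    by_contra! l
    obtain ⟨z, -, hz⟩ := fp.exists_subset_part_bijOn
    have ncf : ¬ G.CliqueFree #z := by
      refine IsNClique.not_cliqueFree ⟨fun v hv w hw hn ↦ ?_, rfl⟩
      contrapose hn
      exact hz.injOn hv hw (by rwa [← hadj])
    rw [Finset.card_eq_of_equiv hz.equiv] at ncf
    exact absurd (hcf.mono (Nat.succ_le_of_lt l)) ncf
  have hcard : #fp.parts = min (Fintype.card V) q := by
    apply le_antisymm (le_min fp.card_parts_le_card hle)
    by_contra! l
    rw [lt_min_iff] at l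
    obtain ⟨x, -, y, -, hn, he⟩ :=
      exists_ne_map_eq_of_card_lt_of_maps_to l.1 fun a _ ↦ fp.part_mem.2 (mem_univ a)
    refine hfull x y hn ((hadj x y).2 he) fun z hz ↦ ?_
    obtain ⟨a, ha, b, hb, hab, hp⟩ := exists_ne_map_eq_of_card_lt_of_maps_to
      (hz.card_eq.symm ▸ l.2) fun a _ ↦ fp.part_mem.2 (mem_univ a)
    exact (hadj a b).2 hp (hz.isClique ha hb hab)
  obtain ⟨zm, zp⟩ := heq.exists_partPreservingEquiv
  refine ⟨(Equiv.subtypeUnivEquiv mem_univ).symm.trans (zm.trans (finCongr card_univ)), ?_⟩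
  intro a b
  simp_rw [turanGraph_adj, Equiv.trans_apply, Equiv.subtypeUnivEquiv_symm_apply]
  have := zp ⟨a, mem_univ a⟩ ⟨b, mem_univ b⟩
  rw [← hadj] at this
  rw [← not_iff_not, not_ne_iff, this, hcard]
  rcases le_or_gt q (Fintype.card V) with c | c
  · rw [min_eq_right c]; rfl
  · have lc : ∀ x, zm ⟨x, mem_univ x⟩ < Fintype.card V := fun x ↦ (zm ⟨x, mem_univ x⟩).2
    rw [min_eq_left c.le, Nat.mod_eq_of_lt (lc a), Nat.mod_eq_of_lt (lc b),
      ← Nat.mod_eq_of_lt ((lc a).trans c), ← Nat.mod_eq_of_lt ((lc b).trans c)]; rfl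

/-- The number of `r`-cliques satisfying `P`, weighted by `a`, minus the number of edges
satisfying `P`, weighted by `b`. -/
noncomputable def cliqueWeight (a b : ℤ) (r : ℕ) (G : SimpleGraph V) (P : Finset V → Prop) : ℤ :=
  a * numCliques r G P - b * numCliques 2 G P

variable {a b : ℤ} {r : ℕ}

/-- **Zykov symmetrization**: if `a ∤ b`, then a graph maximising `a` times the number of
`r`-cliques minus `b` times the number of edges among `q + 1`-clique-free graphs is either
empty or a Turán graph. -/
theorem eq_bot_or_nonempty_iso_turanGraph (ha : 0 ≤ a) (hab : ¬ a ∣ b)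
    (hcf : G.CliqueFree (q + 1))
    (hmax : ∀ H : SimpleGraph V, H.CliqueFree (q + 1) →
      cliqueWeight a b r H (fun _ ↦ True) ≤ cliqueWeight a b r G (fun _ ↦ True)) :
    G = ⊥ ∨ Nonempty (G ≃g turanGraph (Fintype.card V) q) := by
  have hpos : ∀ u v, G.Adj u v → 0 < cliqueWeight a b r G (fun s ↦ u ∈ s ∧ v ∈ s) := by
    intro u v huv
    apply lt_of_le_of_ne
    · have := hmax (G.deleteEdges {s(u, v)}) (hcf.anti (deleteEdges_le _))
      have h1 := numCliques_deleteEdges_add (G := G) (m := r) huv.ne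
      have h2 := numCliques_deleteEdges_add (G := G) (m := 2) huv.ne
      simp only [cliqueWeight, ← h1, ← h2] at this ⊢
      push_cast at this
      linarith
    · intro h
      rw [cliqueWeight, numCliques_two_of_adj huv] at h
      exact hab ⟨numCliques r G (fun s ↦ u ∈ s ∧ v ∈ s), by push_cast at h; linarith⟩
  have hrep : ∀ (H : SimpleGraph V) (v u : V), v ≠ u →
      cliqueWeight a b r (H.replaceVertex v u) (fun _ ↦ True) =
        cliqueWeight a b r H (fun _ ↦ True) + cliqueWeight a b r H (fun s ↦ v ∈ s) -
        cliqueWeight a b r H (fun s ↦ u ∈ s) -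
        cliqueWeight a b r H (fun s ↦ v ∈ s ∧ u ∈ s) := by
    intro H v u hne
    have h1 := congrArg (Nat.cast (R := ℤ)) (numCliques_replaceVertex (G := H) (m := r) hne)
    have h2 := congrArg (Nat.cast (R := ℤ)) (numCliques_replaceVertex (G := H) (m := 2) hne)
    push_cast at h1 h2
    simp only [cliqueWeight]
    linear_combination a * h1 - b * h2
  have hzero : ∀ (H : SimpleGraph V) (u v : V), u ≠ v → ¬ H.Adj u v →
      cliqueWeight a b r H (fun s ↦ u ∈ s ∧ v ∈ s) = 0 := by
    intro H u v hne h
    simp [cliqueWeight, numCliques_of_not_adj hne h]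
  have hmem : ∀ x v u, x ≠ u → ¬ G.Adj v x →
      cliqueWeight a b r (G.replaceVertex v u) (fun s ↦ x ∈ s) =
        cliqueWeight a b r G (fun s ↦ x ∈ s) -
        cliqueWeight a b r G (fun s ↦ x ∈ s ∧ u ∈ s) := by
    intro x v u hx h
    have h1 := congrArg (Nat.cast (R := ℤ)) (numCliques_mem_replaceVertex (m := r) hx h)
    have h2 := congrArg (Nat.cast (R := ℤ)) (numCliques_mem_replaceVertex (m := 2) hx h)
    push_cast at h1 h2
    simp only [cliqueWeight]
    linear_combination a * h1 - b * h2
  have hE : Equivalence (¬ G.Adj · ·) := by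
    refine ⟨by simp, fun h ↦ by rwa [adj_comm], fun {u v w} huv hvw huw ↦ ?_⟩
    have hvu : v ≠ u := by rintro rfl; exact hvw huw
    have hvw' : v ≠ w := by rintro rfl; exact huv huw
    have e1 := hrep G v u hvu
    have e2 := hrep G u v hvu.symm
    rw [hzero G v u hvu (fun h ↦ huv h.symm)] at e1
    rw [hzero G u v hvu.symm huv] at e2
    have i1 := hmax _ (hcf.replaceVertex v u)
    have i2 := hmax _ (hcf.replaceVertex u v)
    have e3 := hrep (G.replaceVertex v u) v w hvw'
    have hvw1 : ¬ (G.replaceVertex v u).Adj v w := by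
      rwa [adj_replaceVertex_iff_of_ne_left _ _ huw.ne']
    rw [hzero _ v w hvw' hvw1, hmem v v u hvu G.irrefl, hmem w v u huw.ne' hvw,
      hzero G v u hvu (fun h ↦ huv h.symm)] at e3
    have i3 := hmax _ ((hcf.replaceVertex v u).replaceVertex v w)
    have e4 := hrep G w v hvw'.symm
    have e5 := hrep G v w hvw'
    rw [hzero G v w hvw' hvw] at e5
    have i5 := hmax _ (hcf.replaceVertex v w)
    rw [hzero G w v hvw'.symm (fun h ↦ hvw h.symm)] at e4
    have i4 := hmax _ (hcf.replaceVertex w v)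
    have := hpos w u huw.symm
    linarith
  rcases eq_or_ne G ⊥ with hbot | hbot
  · exact .inl hbot
  refine .inr (nonempty_iso_turanGraph_of_equivalence hE (fun u v huv ↦ ?_) hcf
    fun x y hne hxy hq ↦ ?_)
  · classical
    by_contra! hlt
    have i := hmax _ (hcf.replaceVertex v u)
    have h1 := congrArg (Nat.cast (R := ℤ)) (numCliques_mem_add (m := r) hE huv.symm)
    have h2 := congrArg (Nat.cast (R := ℤ)) (numCliques_mem_add (m := 2) hE huv.symm)
    push_cast at h1 h2
    rw [hrep G v u huv.ne'] at i
    have p := hpos v u huv.symm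
    have key : cliqueWeight a b r G (fun s ↦ v ∈ s) - cliqueWeight a b r G (fun s ↦ u ∈ s) =
        ((#{x | ¬ G.Adj u x} : ℤ) - #{x | ¬ G.Adj v x}) *
          cliqueWeight a b r G (fun s ↦ v ∈ s ∧ u ∈ s) := by
      simp only [cliqueWeight]
      linear_combination a * h1 - b * h2
    have hlt' : (#{x | ¬ G.Adj v x} : ℤ) + 1 < #{x | ¬ G.Adj u x} := by exact_mod_cast hlt
    nlinarith
  · obtain ⟨c, d, hcd⟩ := ne_bot_iff_exists_adj.1 hbot
    obtain ⟨v, hxv⟩ : ∃ v, G.Adj x v := by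
      by_contra! h
      exact hE.trans (hE.symm (h c)) (h d) hcd
    have i := hmax _ (hq.sup_edge x y)
    have h1 := numCliques_sup_edge (m := r) hne hxy
    have h2 := numCliques_sup_edge (m := 2) hne hxy
    have h3 := numCliques_le_sup_edge (m := r) hE hne hxy hxv
    have hadj : (G ⊔ edge x y).Adj x y := .inr (by simp [adj_edge, hne])
    rw [numCliques_two_of_adj hadj] at h2
    have p := hpos x v hxv
    rw [cliqueWeight, numCliques_two_of_adj hxv] at p
    simp only [cliqueWeight, h1, h2] at i
    push_cast at i p
    have : a * (numCliques r G (fun s ↦ x ∈ s ∧ v ∈ s) : ℤ) ≤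
        a * numCliques r (G ⊔ edge x y) (fun s ↦ x ∈ s ∧ y ∈ s) := by gcongr
    linarith

end Turan

end SimpleGraph

section Extremal

open SimpleGraph

lemma cliqueCount_eq_numCliques {V : Type*} [Fintype V] [DecidableEq V] (r : ℕ)
    (G : SimpleGraph V) : cliqueCount r G = numCliques r G (fun _ ↦ True) := by
  classical
  simp only [cliqueCount, numCliques, cliqueFinset, and_true]

lemma edgeCount_eq_numCliques {V : Type*} [Fintype V] [DecidableEq V] (G : SimpleGraph V) :
    edgeCount G = numCliques 2 G (fun _ ↦ True) := by
  classical
  simp only [edgeCount, numCliques, and_true]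
  refine card_bij (fun e _ ↦ e.toFinset) (fun e ↦ ?_) (fun e _ e' _ h ↦ ?_) fun s hs ↦ ?_
  · induction e with
    | _ a b =>
      intro h
      rw [mem_edgeFinset, mem_edgeSet] at h
      rw [Sym2.toFinset_mk_eq, mem_filter]
      exact ⟨mem_univ _, by simp [isClique_insert, h], card_pair h.ne⟩
  · exact Sym2.ext fun x ↦ by rw [← Sym2.mem_toFinset, h, Sym2.mem_toFinset]
  · obtain ⟨hc, h2⟩ := (mem_filter.1 hs).2
    obtain ⟨a, b, hab, rfl⟩ := card_eq_two.1 h2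
    exact ⟨s(a, b), by simpa using hc (by simp) (by simp) hab, Sym2.toFinset_mk_eq⟩

lemma not_graphContains_top_iff {V : Type*} {k : ℕ} {G : SimpleGraph V} :
    ¬ GraphContains (⊤ : SimpleGraph (Fin k)) G ↔ G.CliqueFree k := by
  rw [cliqueFree_iff, ← not_nonempty_iff, not_iff_not]
  exact ⟨fun ⟨f, hf⟩ ↦ ⟨⟨⟨f, fun {x y} h ↦ hf x y h⟩, f.injective⟩⟩,
    fun ⟨f⟩ ↦ ⟨⟨f, f.injective⟩, fun _ _ h ↦ f.toHom.map_adj h⟩⟩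

lemma le_exClique {α : Type*} {F : SimpleGraph α} {n : ℕ} (r : ℕ) {G : SimpleGraph (Fin n)}
    (h : ¬ GraphContains F G) : cliqueCount r G ≤ exClique n r F :=
  le_csSup ((Set.finite_range (cliqueCount r)).bddAbove.mono (by rintro _ ⟨H, -, rfl⟩; exact ⟨H, rfl⟩))
    ⟨G, h, rfl⟩

lemma le_exTuran {α : Type*} {F : SimpleGraph α} {n : ℕ} {G : SimpleGraph (Fin n)}
    (h : ¬ GraphContains F G) : edgeCount G ≤ exTuran n F :=
  le_csSup ((Set.finite_range edgeCount).bddAbove.mono (by rintro _ ⟨H, -, rfl⟩; exact ⟨H, rfl⟩))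
    ⟨G, h, rfl⟩

lemma exTuran_eq_of_iso {n q : ℕ} (hq : 0 < q) {G : SimpleGraph (Fin n)}
    (f : G ≃g turanGraph n q) : exTuran n (⊤ : SimpleGraph (Fin (q + 1))) = edgeCount G := by
  classical
  have hG := isTuranMaximal_of_iso f hq
  apply le_antisymm
  · refine csSup_le ⟨_, G, not_graphContains_top_iff.2 hG.1, rfl⟩ ?_
    rintro _ ⟨H, hH, rfl⟩
    convert! hG.2 (not_graphContains_top_iff.1 hH)
  · exact le_exTuran (not_graphContains_top_iff.2 hG.1)

/-- Among `K_{q+1}`-free graphs, the number of `r`-cliques minus `t` times the number of edges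
is maximised by the Turán graph or the empty graph. -/
theorem cliqueCount_sub_mul_edgeCount_le {n r q t : ℕ} (hq : 0 < q) (hr : 2 ≤ r)
    {H : SimpleGraph (Fin n)} (hH : H.CliqueFree (q + 1)) :
    (cliqueCount r H : ℤ) - t * edgeCount H ≤
      max 0 ((exClique n r (⊤ : SimpleGraph (Fin (q + 1))) : ℤ) -
        t * exTuran n (⊤ : SimpleGraph (Fin (q + 1)))) := by
  -- Perturbing the weights by `1 / M` breaks ties between adjacent and nonadjacent pairs.
  set M : ℤ := exTuran n (⊤ : SimpleGraph (Fin (q + 1))) + 2 with hM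
  have hM2 : 2 ≤ M := by lia
  obtain ⟨G, hG, hmax⟩ := Set.exists_max_image {G : SimpleGraph (Fin n) | G.CliqueFree (q + 1)}
    (fun G ↦ cliqueWeight M (M * t - 1) r G (fun _ ↦ True)) (Set.toFinite _) ⟨H, hH⟩
  have hdvd : ¬ M ∣ M * t - 1 := by
    intro h
    have := Int.le_of_dvd one_pos ((Int.dvd_iff_dvd_of_dvd_sub h).1 (dvd_mul_right M t))
    lia
  have hle := hmax H hH
  simp only [cliqueWeight, ← edgeCount_eq_numCliques, ← cliqueCount_eq_numCliques r] at hle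
  have hHe := le_exTuran (not_graphContains_top_iff.2 hH)
  rcases eq_bot_or_nonempty_iso_turanGraph (by lia) hdvd hG hmax with rfl | ⟨⟨f⟩⟩
  · have h1 : cliqueCount r (⊥ : SimpleGraph (Fin n)) = 0 := by
      rw [cliqueCount_eq_numCliques]
      exact numCliques_eq_zero fun s hs ↦ (cliqueFree_bot hr s hs).elim
    have h2 : edgeCount (⊥ : SimpleGraph (Fin n)) = 0 := by
      simp [edgeCount]
    rw [h1, h2] at hle
    refine le_max_of_le_left ?_
    by_contra! hlt
    have := mul_pos (by lia : 0 < M) hlt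
    have : (0 : ℤ) ≤ edgeCount H := by positivity
    push_cast at hle
    linarith
  · rw [Fintype.card_fin] at f
    have hGe := exTuran_eq_of_iso hq f
    have hGr := le_exClique r (not_graphContains_top_iff.2 hG)
    refine le_max_of_le_right ?_
    rw [← hGe] at hle
    by_contra! hlt
    have h1 : M * cliqueCount r G ≤ M * exClique n r (⊤ : SimpleGraph (Fin (q + 1))) := by
      gcongr
    nlinarith

lemma edgeCount_sup {V : Type*} [Fintype V] [DecidableEq V] {G H : SimpleGraph V}
    (h : G ⊓ H = ⊥) : edgeCount (G ⊔ H) = edgeCount G + edgeCount H := by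
  classical
  simp only [edgeCount]
  rw [← card_union_of_disjoint]
  · congr 1
    ext e
    simp
  · rw [← disjoint_coe, coe_edgeFinset, coe_edgeFinset, disjoint_edgeSet]
    exact disjoint_iff.2 h

end Extremal

theorem blue_red_clique_bound (n r k t : ℕ) (hk : r < k) (hr : 2 < r) (ht : 1 ≤ t)
    (G Gb Gr : SimpleGraph (Fin n)) (hsup : Gb ⊔ Gr = G) (hdisj : Gb ⊓ Gr = ⊥)
    (hfree : ¬ GraphContains (⊤ : SimpleGraph (Fin k)) G) :
    (cliqueCount r Gb : ℝ) + (t : ℝ) * (edgeCount Gr : ℝ) +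
        ((t : ℝ) - 1) * ((n.choose 2 : ℝ) - (edgeCount G : ℝ)) ≤
      ((t : ℝ) - 1) * (n.choose 2 : ℝ) +
        max ((exClique n r (⊤ : SimpleGraph (Fin k)) : ℝ) -
              ((t : ℝ) - 1) * (exTuran n (⊤ : SimpleGraph (Fin k)) : ℝ))
            (exTuran n (⊤ : SimpleGraph (Fin k)) : ℝ) := by
  subst hsup
  obtain ⟨q, rfl⟩ : ∃ q, k = q + 1 := ⟨k - 1, by lia⟩
  have hGb : Gb.CliqueFree (q + 1) := (not_graphContains_top_iff.1 hfree).anti le_sup_left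
  have hle := cliqueCount_sub_mul_edgeCount_le (t := t) (by lia) hr.le hGb
  have hedge := le_exTuran hfree
  have hsum := edgeCount_sup hdisj
  have hle' : (cliqueCount r Gb : ℝ) - t * edgeCount Gb ≤
      max 0 ((exClique n r (⊤ : SimpleGraph (Fin (q + 1))) : ℝ) -
        t * exTuran n (⊤ : SimpleGraph (Fin (q + 1)))) := by
    exact_mod_cast hle
  have hedge' : (edgeCount (Gb ⊔ Gr) : ℝ) ≤ exTuran n (⊤ : SimpleGraph (Fin (q + 1))) := by
    exact_mod_cast hedge
  have hsum' : (edgeCount (Gb ⊔ Gr) : ℝ) = edgeCount Gb + edgeCount Gr := by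
    exact_mod_cast hsum
  rw [hsum'] at hedge' ⊢
  rw [← sub_le_iff_le_add', le_max_iff]
  rcases le_max_iff.1 hle' with h | h
  · right; linarith
  · left; linarith
end

section
/- For k > r > 2, t ≥ 1 and n sufficiently large, ex_r(n, B_t K_k) = ex_r(n, H_t K_k) = |Q^r_t(n, k−1)|, where |Q^r_t(n, k−1)| = ex(n, K_r, K_k) + (t−1)·(C(n,2) − ex(n, K_k)). -/
open Finset

/-- The elementary symmetric sum of degree `r` of the numbers `a i`, `i ∈ I`. -/
def elemSum (I : Finset ℕ) (a : ℕ → ℕ) (r : ℕ) : ℕ :=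
  ∑ S ∈ I.powersetCard r, ∏ i ∈ S, a i

lemma elemSum_zero (I : Finset ℕ) (a : ℕ → ℕ) : elemSum I a 0 = 1 := by
  simp [elemSum]

lemma elemSum_one (I : Finset ℕ) (a : ℕ → ℕ) : elemSum I a 1 = ∑ i ∈ I, a i := by
  simp [elemSum, powersetCard_one]

lemma elemSum_insert {I : Finset ℕ} {i : ℕ} (hi : i ∉ I) (a : ℕ → ℕ) (r : ℕ) :
    elemSum (insert i I) a (r + 1) = elemSum I a (r + 1) + a i * elemSum I a r := by
  unfold elemSum
  rw [powersetCard_succ_insert hi, sum_union, sum_image, mul_sum]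
  · congr 1
    refine sum_congr rfl fun S hS => ?_
    rw [prod_insert fun h => hi ((mem_powersetCard.1 hS).1 h)]
  · intro S hS T hT h
    have hS' : i ∉ S := fun h' => hi ((mem_powersetCard.1 hS).1 h')
    have hT' : i ∉ T := fun h' => hi ((mem_powersetCard.1 hT).1 h')
    rw [← erase_insert hS', ← erase_insert hT']
    exact congrArg (fun X => X.erase i) h
  · rw [disjoint_left]
    intro S hS hS'
    obtain ⟨T, -, rfl⟩ := mem_image.1 hS'
    exact hi ((mem_powersetCard.1 hS).1 (mem_insert_self _ _))

lemma elemSum_congr {I : Finset ℕ} {a b : ℕ → ℕ} (h : ∀ i ∈ I, a i = b i) (r : ℕ) :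
    elemSum I a r = elemSum I b r :=
  sum_congr rfl fun _ hS => prod_congr rfl fun i hi => h i ((mem_powersetCard.1 hS).1 hi)

lemma elemSum_mono {I : Finset ℕ} {a b : ℕ → ℕ} (h : ∀ i ∈ I, a i ≤ b i) (r : ℕ) :
    elemSum I a r ≤ elemSum I b r :=
  sum_le_sum fun _ hS => prod_le_prod' fun i hi => h i ((mem_powersetCard.1 hS).1 hi)

lemma elemSum_const (I : Finset ℕ) (q r : ℕ) :
    elemSum I (fun _ => q) r = (#I).choose r * q ^ r := by
  unfold elemSum
  rw [sum_congr rfl fun S hS => show ∏ _i ∈ S, q = q ^ r by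
    rw [prod_const, (mem_powersetCard.1 hS).2]]
  rw [sum_const, card_powersetCard, smul_eq_mul]

lemma le_elemSum {I : Finset ℕ} {a : ℕ → ℕ} {q r : ℕ} (hr : r ≠ 0) (hI : r ≤ #I)
    (hq : ∀ i ∈ I, q ≤ a i) : q ≤ elemSum I a r := by
  refine le_trans ?_ (elemSum_mono hq r)
  rw [elemSum_const]
  calc q ≤ q ^ r := Nat.le_self_pow hr q
    _ ≤ _ := Nat.le_mul_of_pos_left _ (Nat.choose_pos hI)

/-- Moving the vector `a` towards a balanced vector `b` of the same sum does not decrease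
`elemSum (r + 2) - l * elemSum 2`. -/
lemma elemSum_le_of_balanced {I : Finset ℕ} {b : ℕ → ℕ} (r l q : ℕ)
    (hb : ∀ i ∈ I, ∀ j ∈ I, b i ≤ b j + 1)
    (hbq : ∀ i ∈ I, q ≤ b i)
    (hl : ∀ a : ℕ → ℕ, (∀ i ∈ I, q ≤ a i) → ∀ i ∈ I, ∀ j ∈ I, i ≠ j →
      l ≤ elemSum ((I.erase i).erase j) a r) (N : ℕ) :
    ∀ a : ℕ → ℕ, (∀ i ∈ I, q ≤ a i) → ∑ i ∈ I, a i = ∑ i ∈ I, b i →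
      ∑ i ∈ I, (a i - b i) = N →
      elemSum I a (r + 2) + l * elemSum I b 2 ≤ elemSum I b (r + 2) + l * elemSum I a 2 := by
  induction N with
  | zero =>
    intro a haq hs h0
    have hle : ∀ i ∈ I, a i ≤ b i := fun i hi => by
      have := (sum_eq_zero_iff.1 h0) i hi
      omega
    have heq := (sum_eq_sum_iff_of_le hle).1 hs
    rw [elemSum_congr heq, elemSum_congr heq]
  | succ N ih =>
    intro a haq hs hN
    obtain ⟨i, hi, hai⟩ : ∃ i ∈ I, b i < a i := by
      by_contra! h
      rw [sum_eq_zero fun i hi => Nat.sub_eq_zero_of_le (h i hi)] at hN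
      omega
    obtain ⟨j, hj, haj⟩ : ∃ j ∈ I, a j < b j := by
      by_contra! h
      exact (sum_lt_sum h ⟨i, hi, hai⟩).ne' hs
    have hij : i ≠ j := by rintro rfl; omega
    have hbij := hb j hj i hi
    set K := (I.erase i).erase j with hK
    have hjK : j ∉ K := by simp [hK]
    have hiK : i ∉ insert j K := by simp [hK, hij]
    have hI : I = insert i (insert j K) := by
      rw [hK, insert_erase (mem_erase.2 ⟨hij.symm, hj⟩), insert_erase hi]
    set a' : ℕ → ℕ := Function.update (Function.update a i (a i - 1)) j (a j + 1) with ha'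
    have a'i : a' i = a i - 1 := by simp [ha', hij]
    have a'j : a' j = a j + 1 := by simp [ha']
    have a'K : ∀ x ∈ K, a' x = a x := fun x hx => by
      simp only [hK, mem_erase] at hx
      simp [ha', hx.1, hx.2.1]
    have expand : ∀ (f : ℕ → ℕ) (s : ℕ), elemSum I f (s + 2) =
        elemSum K f (s + 2) + (f i + f j) * elemSum K f (s + 1) + f i * f j * elemSum K f s := by
      intro f s
      rw [hI, elemSum_insert hiK, elemSum_insert hjK, elemSum_insert hjK]
      ring
    have sumI : ∀ f : ℕ → ℕ, ∑ x ∈ I, f x = f i + (f j + ∑ x ∈ K, f x) := by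
      intro f
      rw [hI, sum_insert hiK, sum_insert hjK]
    have key := ih a' ?_ ?_ ?_
    · have hlK := hl a haq i hi j hj hij
      rw [← hK] at hlK
      have e1 := expand a r
      have e2 := expand a' r
      have e3 := expand a 0
      have e4 := expand a' 0
      simp only [elemSum_congr a'K, a'i, a'j, zero_add, elemSum_zero, mul_one] at e1 e2 e3 e4
      obtain ⟨d, hd⟩ : ∃ d, a i = a j + 1 + d := ⟨a i - (a j + 1), by omega⟩
      obtain ⟨e, he⟩ : ∃ e, elemSum K a r = l + e := ⟨_, (Nat.add_sub_of_le hlK).symm⟩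
      rw [e2, e4] at key
      rw [e1, e3]
      rw [hd, he] at key ⊢
      rw [show a j + 1 + d - 1 = a j + d by omega] at key
      nlinarith [Nat.zero_le (d * e)]
    · intro x hx
      rw [hI] at hx
      rcases mem_insert.1 hx with rfl | hx
      · have := hbq x hi
        omega
      rcases mem_insert.1 hx with rfl | hx
      · have := haq x hj
        omega
      · rw [a'K x hx]
        exact haq x (by rw [hI]; simp [hx])
    · have hsum : ∑ x ∈ K, a' x = ∑ x ∈ K, a x := sum_congr rfl a'K
      rw [← hs, sumI, sumI, a'i, a'j, hsum]
      omega
    · rw [sumI] at hN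
      rw [sumI, a'i, a'j, sum_congr rfl fun x hx => by rw [a'K x hx]]
      omega

/-- The part sizes of the balanced partition of `n` elements into `p` parts. -/
def balancedSize (n p i : ℕ) : ℕ := n / p + if i < n % p then 1 else 0

lemma sum_balancedSize {n p : ℕ} (hp : 0 < p) : ∑ i ∈ range p, balancedSize n p i = n := by
  unfold balancedSize
  rw [sum_add_distrib, sum_const, card_range, smul_eq_mul, sum_boole]
  have : (range p).filter (fun i => i < n % p) = range (n % p) := by
    ext i
    have := Nat.mod_lt n hp
    simp only [mem_filter, mem_range]
    omega
  rw [this, card_range]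
  exact Nat.div_add_mod n p

lemma div_le_balancedSize (n p i : ℕ) : n / p ≤ balancedSize n p i := Nat.le_add_right _ _

lemma balancedSize_le (n p i : ℕ) : balancedSize n p i ≤ n / p + 1 := by
  unfold balancedSize
  split_ifs <;> omega

/-- The number of `r`-cliques of the Turán graph with `p` parts on `n` vertices. -/
def turanCliques (n p r : ℕ) : ℕ := elemSum (range p) (balancedSize n p) r

lemma elemSum_le_turanCliques {p : ℕ} (hp : 0 < p) (a : ℕ → ℕ) (r : ℕ) :
    elemSum (range p) a r ≤ turanCliques (∑ i ∈ range p, a i) p r := by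
  match r with
  | 0 => simp [turanCliques, elemSum_zero]
  | 1 => simp [turanCliques, elemSum_one, sum_balancedSize hp]
  | r + 2 =>
    have := elemSum_le_of_balanced (I := range p)
      (b := balancedSize (∑ i ∈ range p, a i) p) r 0 0
      (fun i _ j _ => (balancedSize_le _ _ _).trans
        (Nat.add_le_add_right (div_le_balancedSize _ _ _) 1))
      (fun _ _ => Nat.zero_le _) (fun _ _ _ _ _ _ _ => Nat.zero_le _) _ a
      (fun _ _ => Nat.zero_le _) (sum_balancedSize hp).symm rfl
    simpa [turanCliques] using this

/-- Among near-balanced part sizes, the balanced ones maximise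
`elemSum r - l * elemSum 2`. -/
lemma elemSum_add_le_turanCliques {p r l : ℕ} (hr : 2 < r) (hrp : r ≤ p) {a : ℕ → ℕ} {n : ℕ}
    (hn : l ≤ n / p) (ha : ∀ i ∈ range p, l ≤ a i) (hs : ∑ i ∈ range p, a i = n) :
    elemSum (range p) a r + l * turanCliques n p 2 ≤
      turanCliques n p r + l * elemSum (range p) a 2 := by
  obtain ⟨s, rfl⟩ : ∃ s, r = s + 2 := ⟨r - 2, by omega⟩
  refine elemSum_le_of_balanced (I := range p) (b := balancedSize n p) s l l
      (fun i _ j _ => (balancedSize_le _ _ _).trans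
        (Nat.add_le_add_right (div_le_balancedSize _ _ _) 1))
      (fun i _ => hn.trans (div_le_balancedSize _ _ _)) ?_ _ a
      ha (hs.trans (sum_balancedSize (by omega)).symm) rfl
  intro a' ha' i hi j hj hij
  refine le_elemSum (by omega) ?_ fun x hx => ha' x (mem_of_mem_erase (mem_of_mem_erase hx))
  rw [card_erase_of_mem (mem_erase.2 ⟨hij.symm, hj⟩), card_erase_of_mem hi, card_range]
  omega

lemma turanCliques_le (n p r : ℕ) : turanCliques n p r ≤ p.choose r * (n / p + 1) ^ r := by
  refine (elemSum_mono (fun i _ => balancedSize_le n p i) r).trans ?_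
  rw [elemSum_const, card_range]

lemma add_choose_two (x y : ℕ) : (x + y).choose 2 = x.choose 2 + y.choose 2 + x * y := by
  induction y with
  | zero => simp
  | succ y ih =>
    rw [← add_assoc, Nat.choose_succ_succ' (x + y) 1, Nat.choose_succ_succ' y 1, ih]
    simp only [Nat.choose_one_right]
    ring

lemma elemSum_two_le (I : Finset ℕ) (a : ℕ → ℕ) :
    elemSum I a 2 ≤ (∑ i ∈ I, a i).choose 2 := by
  induction I using Finset.induction_on with
  | empty => simp [elemSum]
  | insert i I hi ih =>
    have h : elemSum (insert i I) a 2 = elemSum I a 2 + a i * ∑ i ∈ I, a i := by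
      rw [elemSum_insert hi, elemSum_one]
    rw [h, sum_insert hi, add_choose_two]
    omega

lemma turanCliques_two_le {n p : ℕ} (hp : 0 < p) : turanCliques n p 2 ≤ n.choose 2 := by
  have := elemSum_two_le (range p) (balancedSize n p)
  rwa [sum_balancedSize hp] at this

/-- Adding `b` vertices to the balanced partition of `m` vertices. -/
lemma turanCliques_add_le {p r l m b : ℕ} (hr : 2 < r) (hrp : r ≤ p) (hl : l ≤ m / p) :
    turanCliques m p r + l * (m.choose 2 - turanCliques m p 2) +
      b * ((p - 1).choose (r - 1) * (m / p) ^ (r - 1)) ≤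
    turanCliques (m + b) p r + l * ((m + b).choose 2 - turanCliques (m + b) p 2) := by
  have hp : 0 < p := by omega
  obtain ⟨s, rfl⟩ : ∃ s, r = s + 1 := ⟨r - 1, by omega⟩
  set K := (range p).erase 0 with hK
  have h0K : 0 ∉ K := by simp [hK]
  have hI : range p = insert 0 K := by rw [hK, insert_erase (mem_range.2 hp)]
  have hKc : #K = p - 1 := by rw [hK, card_erase_of_mem (mem_range.2 hp), card_range]
  set a : ℕ → ℕ := Function.update (balancedSize m p) 0 (balancedSize m p 0 + b) with ha
  have a0 : a 0 = balancedSize m p 0 + b := by simp [ha]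
  have aK : ∀ i ∈ K, a i = balancedSize m p i := fun i hi => by
    simp [ha, ne_of_mem_of_not_mem hi h0K]
  have hsm := sum_balancedSize (n := m) hp
  have hsa : ∑ i ∈ range p, a i = m + b := by
    rw [hI, sum_insert h0K] at hsm ⊢
    have hsK : ∑ i ∈ K, a i = ∑ i ∈ K, balancedSize m p i := sum_congr rfl aK
    rw [hsK, a0]
    omega
  have hmain := elemSum_add_le_turanCliques hr hrp (a := a) (l := l)
    (hl.trans (Nat.div_le_div_right (Nat.le_add_right m b)))
    (fun i hi => hl.trans ((div_le_balancedSize m p i).trans (by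
      rw [hI] at hi
      rcases mem_insert.1 hi with rfl | hi
      · rw [a0]; omega
      · rw [aK i hi]))) hsa
  have hA : elemSum (range p) a (s + 1) =
      turanCliques m p (s + 1) + b * elemSum K (balancedSize m p) s := by
    rw [turanCliques, hI, elemSum_insert h0K, elemSum_insert h0K, elemSum_congr aK,
      elemSum_congr aK, a0]
    ring
  have hB : elemSum (range p) a 2 ≤ turanCliques m p 2 + m * b := by
    rw [turanCliques, hI, elemSum_insert h0K, elemSum_insert h0K, elemSum_congr aK,
      elemSum_congr aK, a0, elemSum_one]
    rw [hI, sum_insert h0K] at hsm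
    nlinarith [Nat.zero_le (b * balancedSize m p 0)]
  have hC : (p - 1).choose s * (m / p) ^ s ≤ elemSum K (balancedSize m p) s := by
    rw [← hKc, ← elemSum_const]
    exact elemSum_mono (fun i _ => div_le_balancedSize m p i) s
  have hC' := Nat.mul_le_mul_left b hC
  have h1 := turanCliques_two_le (n := m) hp
  have h2 := turanCliques_two_le (n := m + b) hp
  have h3 := add_choose_two m b
  obtain ⟨x, hx⟩ := Nat.exists_eq_add_of_le h1
  obtain ⟨y, hy⟩ := Nat.exists_eq_add_of_le h2
  rw [hx, hy, Nat.add_sub_cancel_left, Nat.add_sub_cancel_left, Nat.add_sub_cancel]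
  rw [hA] at hmain
  have hB' : l * (elemSum (range p) a 2 + x) ≤ l * (turanCliques (m + b) p 2 + y) :=
    Nat.mul_le_mul_left l (by omega)
  rw [mul_add, mul_add] at hB'
  omega

lemma turanCliques_mono {p : ℕ} (hp : 0 < p) (r : ℕ) {m n : ℕ} (h : m ≤ n) :
    turanCliques m p r ≤ turanCliques n p r := by
  have hsm := sum_balancedSize (n := m) hp
  have h1 := elemSum_le_turanCliques hp
    (Function.update (balancedSize m p) 0 (balancedSize m p 0 + (n - m))) r
  have h2 : ∑ i ∈ range p, Function.update (balancedSize m p) 0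
      (balancedSize m p 0 + (n - m)) i = n := by
    rw [sum_update_of_mem (mem_range.2 hp)]
    rw [← add_sum_erase _ _ (mem_range.2 hp), erase_eq] at hsm
    omega
  rw [h2] at h1
  refine (elemSum_mono (fun i _ => ?_) r).trans h1
  by_cases hi : i = 0
  · subst hi; simp
  · simp [hi]

section Cliques

variable {V : Type*} [DecidableEq V]

open Classical in
/-- The number of `r`-cliques of `G` inside `W`. -/
noncomputable def cliquesIn (G : SimpleGraph V) (W : Finset V) (r : ℕ) : ℕ :=
  #((W.powersetCard r).filter fun A : Finset V => G.IsClique (A : Set V))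

open Classical in
/-- The neighbours of `v` in `W`. -/
noncomputable def nbrsIn (G : SimpleGraph V) (W : Finset V) (v : V) : Finset V :=
  {u ∈ W | G.Adj v u}

lemma cliquesIn_zero (G : SimpleGraph V) (W : Finset V) : cliquesIn G W 0 = 1 := by
  classical
  unfold cliquesIn
  rw [powersetCard_zero, filter_singleton]
  simp

open Classical in
lemma card_cliques_meeting_le (G : SimpleGraph V) (W B : Finset V) (r : ℕ) :
    #((W.powersetCard (r + 1)).filter fun A : Finset V => G.IsClique (A : Set V) ∧ ¬ Disjoint A B) ≤
      ∑ v ∈ B, cliquesIn G (nbrsIn G W v) r := by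
  have hsub : ((W.powersetCard (r + 1)).filter fun A : Finset V =>
      G.IsClique (A : Set V) ∧ ¬ Disjoint A B) ⊆
      B.biUnion fun v => image (insert v)
        (((nbrsIn G W v).powersetCard r).filter fun A : Finset V => G.IsClique (A : Set V)) := by
    intro A hA
    obtain ⟨hA, hcl, hm⟩ := mem_filter.1 hA
    obtain ⟨hAW, hAc⟩ := mem_powersetCard.1 hA
    obtain ⟨v, hvA, hvB⟩ := not_disjoint_iff.1 hm
    refine mem_biUnion.2 ⟨v, hvB, mem_image.2 ⟨A.erase v, ?_, insert_erase hvA⟩⟩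
    refine mem_filter.2 ⟨mem_powersetCard.2 ⟨fun x hx => ?_, ?_⟩, ?_⟩
    · obtain ⟨hxv, hxA⟩ := mem_erase.1 hx
      exact mem_filter.2 ⟨hAW hxA, hcl (mem_coe.2 hvA) (mem_coe.2 hxA) hxv.symm⟩
    · rw [card_erase_of_mem hvA, hAc]; rfl
    · exact hcl.subset (coe_subset.2 (erase_subset _ _))
  exact (card_le_card hsub).trans (card_biUnion_le.trans (sum_le_sum fun v _ => card_image_le))

lemma cliquesIn_le_sdiff_add (G : SimpleGraph V) (W B : Finset V) (r : ℕ) :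
    cliquesIn G W (r + 1) ≤
      cliquesIn G (W \ B) (r + 1) + ∑ v ∈ B, cliquesIn G (nbrsIn G W v) r := by
  classical
  refine le_trans ?_ (Nat.add_le_add_left (card_cliques_meeting_le G W B r) _)
  unfold cliquesIn
  refine le_trans (card_le_card ?_) (card_union_le _ _)
  intro A hA
  obtain ⟨hA, hcl⟩ := mem_filter.1 hA
  obtain ⟨hAW, hAc⟩ := mem_powersetCard.1 hA
  rw [mem_union]
  by_cases hm : Disjoint A B
  · left
    exact mem_filter.2 ⟨mem_powersetCard.2 ⟨subset_sdiff.2 ⟨hAW, hm⟩, hAc⟩, hcl⟩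
  · right
    exact mem_filter.2 ⟨hA, hcl, hm⟩

/-- Zykov's theorem: the Turán graph has the most `r`-cliques among `K_{p+1}`-free graphs. -/
lemma cliquesIn_le_turanCliques (G : SimpleGraph V) (p : ℕ) : ∀ (W : Finset V),
    (∀ A ⊆ W, #A = p + 1 → ¬ G.IsClique (A : Set V)) → ∀ r,
      cliquesIn G W r ≤ turanCliques #W p r := by
  classical
  induction p with
  | zero =>
    intro W hW r
    have hW0 : W = ∅ := by
      rw [eq_empty_iff_forall_notMem]
      intro v hv
      exact hW {v} (singleton_subset_iff.2 hv) (card_singleton v) (by simp)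
    subst hW0
    cases r with
    | zero => simp [cliquesIn_zero, turanCliques, elemSum_zero]
    | succ r => simp [cliquesIn, powersetCard_eq_empty.2 (show #(∅ : Finset V) < r + 1 by simp)]
  | succ p ih =>
    intro W hW r
    cases r with
    | zero => simp [cliquesIn_zero, turanCliques, elemSum_zero]
    | succ r =>
      rcases W.eq_empty_or_nonempty with rfl | hne
      · simp [cliquesIn, powersetCard_eq_empty.2 (show #(∅ : Finset V) < r + 1 by simp)]
      obtain ⟨v, hv, hmax⟩ := exists_max_image W (fun v => cliquesIn G (nbrsIn G W v) r) hne
      set N := nbrsIn G W v with hN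
      have hNW : N ⊆ W := filter_subset _ _
      have hfree : ∀ A ⊆ N, #A = p + 1 → ¬ G.IsClique (A : Set V) := by
        intro A hA hAc hcl
        have hvA : v ∉ A := fun h => G.irrefl (mem_filter.1 (hA h)).2
        refine hW (insert v A) (insert_subset hv (hA.trans hNW)) ?_ ?_
        · rw [card_insert_of_notMem hvA, hAc]
        · rw [coe_insert]
          refine hcl.insert fun u hu _ => (mem_filter.1 (hA (mem_coe.1 hu))).2
      have h1 := cliquesIn_le_sdiff_add G W (W \ N) r
      rw [Finset.sdiff_sdiff_eq_self hNW] at h1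
      have h2 : ∑ u ∈ W \ N, cliquesIn G (nbrsIn G W u) r ≤ #(W \ N) * cliquesIn G N r := by
        rw [← smul_eq_mul]
        exact sum_le_card_nsmul _ _ _ fun u hu => hmax u (mem_sdiff.1 hu).1
      have h3 := ih N hfree (r + 1)
      have h4 := ih N hfree r
      set a : ℕ → ℕ := Function.update (balancedSize #N p) p #(W \ N) with ha
      have ap : a p = #(W \ N) := by simp [ha]
      have aI : ∀ i ∈ range p, a i = balancedSize #N p i := fun i hi => by
        simp [ha, (mem_range.1 hi).ne]
      have h5 := elemSum_le_turanCliques (Nat.succ_pos p) a (r + 1)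
      have hsum : ∑ i ∈ range (p + 1), a i = #W := by
        have hNp : ∑ i ∈ range p, a i = #N := by
          rcases Nat.eq_zero_or_pos p with rfl | hp
          · symm
            rw [range_zero, sum_empty, card_eq_zero, eq_empty_iff_forall_notMem]
            intro x hx
            exact hfree {x} (singleton_subset_iff.2 hx) (card_singleton x) (by simp)
          · rw [sum_congr rfl aI, sum_balancedSize hp]
        rw [sum_range_succ, hNp, ap, add_comm]
        exact card_sdiff_add_card_eq_card hNW
      rw [hsum, range_add_one, elemSum_insert notMem_range_self, elemSum_congr aI,
        elemSum_congr aI, ap] at h5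
      calc cliquesIn G W (r + 1) ≤ cliquesIn G N (r + 1) + #(W \ N) * cliquesIn G N r :=
            h1.trans (Nat.add_le_add_left h2 _)
        _ ≤ turanCliques #N p (r + 1) + #(W \ N) * turanCliques #N p r :=
            Nat.add_le_add h3 (Nat.mul_le_mul_left _ h4)
        _ ≤ _ := h5

open Classical in
/-- The number of `r`-subsets of `W` whose elements get distinct colours, all from `I`. -/
lemma card_rainbow (c : V → ℕ) (W : Finset V) (I : Finset ℕ) : ∀ r,
    #((W.powersetCard r).filter fun A : Finset V => Set.InjOn c (A : Set V) ∧ ∀ x ∈ A, c x ∈ I) =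
      elemSum I (fun i => #{x ∈ W | c x = i}) r := by
  induction I using Finset.induction_on with
  | empty =>
    intro r
    cases r with
    | zero =>
      rw [elemSum_zero, powersetCard_zero, filter_singleton]
      simp
    | succ r =>
      simp only [elemSum, notMem_empty, powersetCard_eq_empty.2 (show #(∅ : Finset ℕ) < r + 1 by simp),
        sum_empty]
      rw [card_eq_zero, filter_eq_empty_iff]
      rintro A hA ⟨-, h⟩
      obtain ⟨x, hx⟩ := card_pos.1 (show 0 < #A by rw [(mem_powersetCard.1 hA).2]; omega)
      exact h x hx
  | insert i I hi ih =>
    intro r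
    cases r with
    | zero =>
      rw [elemSum_zero, powersetCard_zero, filter_singleton]
      simp
    | succ r =>
      rw [elemSum_insert hi, ← ih, ← ih, ← card_product]
      have himg : #({x ∈ W | c x = i} ×ˢ
          ((W.powersetCard r).filter fun A : Finset V => Set.InjOn c (A : Set V) ∧ ∀ x ∈ A, c x ∈ I)) =
          #(({x ∈ W | c x = i} ×ˢ
          ((W.powersetCard r).filter fun A : Finset V => Set.InjOn c (A : Set V) ∧ ∀ x ∈ A, c x ∈ I)).image
            fun z => insert z.1 z.2) := by
        symm
        apply card_image_of_injOn
        rintro ⟨x, A⟩ hxA ⟨y, B⟩ hyB h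
        simp only [coe_product, Set.mem_prod, mem_coe, mem_filter] at hxA hyB h
        have hxB : x ∉ B := fun hh => hi (hxA.1.2 ▸ hyB.2.2.2 x hh)
        have hxA' : x ∉ A := fun hh => hi (hxA.1.2 ▸ hxA.2.2.2 x hh)
        have hxy : x = y := by
          have : x ∈ insert y B := h ▸ mem_insert_self x A
          exact (mem_insert.1 this).resolve_right hxB
        subst hxy
        rw [← erase_insert hxA', ← erase_insert hxB, h]
      rw [himg, ← card_union_of_disjoint]
      · congr 1
        ext A
        simp only [mem_filter, mem_union, mem_image, mem_product, Prod.exists, mem_powersetCard]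
        constructor
        · rintro ⟨⟨hAW, hAc⟩, hinj, hcol⟩
          by_cases hx : ∃ x ∈ A, c x = i
          · right
            obtain ⟨x, hxA, hxi⟩ := hx
            refine ⟨x, A.erase x, ⟨⟨hAW hxA, hxi⟩, ⟨(erase_subset _ _).trans hAW, ?_⟩, ?_, ?_⟩,
              insert_erase hxA⟩
            · rw [card_erase_of_mem hxA, hAc]; rfl
            · exact hinj.mono (coe_subset.2 (erase_subset _ _))
            · intro y hy
              obtain ⟨hyx, hyA⟩ := mem_erase.1 hy
              refine (mem_insert.1 (hcol y hyA)).resolve_left fun hyi => hyx ?_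
              exact hinj hyA hxA (hyi.trans hxi.symm)
          · left
            push Not at hx
            exact ⟨⟨hAW, hAc⟩, hinj, fun y hy =>
              (mem_insert.1 (hcol y hy)).resolve_left (hx y hy)⟩
        · rintro (⟨h1, h2, h3⟩ | ⟨x, B, ⟨⟨hxW, hxi⟩, ⟨hBW, hBc⟩, hinj, hcol⟩, rfl⟩)
          · exact ⟨h1, h2, fun x hx => mem_insert_of_mem (h3 x hx)⟩
          · have hxB : x ∉ B := fun hh => hi (hxi ▸ hcol x hh)
            refine ⟨⟨insert_subset hxW hBW, by rw [card_insert_of_notMem hxB, hBc]⟩, ?_, ?_⟩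
            · rw [coe_insert, Set.injOn_insert (by exact_mod_cast hxB)]
              refine ⟨hinj, ?_⟩
              rintro ⟨y, hy, hyx⟩
              exact hi (hxi ▸ hyx ▸ hcol y hy)
            · intro y hy
              rcases mem_insert.1 hy with rfl | hy
              · exact hxi ▸ mem_insert_self _ _
              · exact mem_insert_of_mem (hcol y hy)
      · rw [disjoint_left]
        intro A hA hA'
        obtain ⟨⟨x, B⟩, hz, rfl⟩ := mem_image.1 hA'
        have := (mem_filter.1 hA).2.2 x (mem_insert_self _ _)
        rw [(mem_filter.1 (mem_product.1 hz).1).2] at this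
        exact hi this

end Cliques

/-- Greedy choice of pairwise disjoint `t`-subsets of large sets. -/
lemma exists_disjoint_subsets {ι β : Type*} [DecidableEq ι] [DecidableEq β] (t : ℕ)
    (S : ι → Finset β) (I : Finset ι) : (∀ e ∈ I, t * #I ≤ #(S e)) →
    ∃ h : ι → Finset β, (∀ e ∈ I, h e ⊆ S e ∧ #(h e) = t) ∧
      ∀ e ∈ I, ∀ e' ∈ I, e ≠ e' → Disjoint (h e) (h e') := by
  induction I using Finset.induction_on with
  | empty => exact fun _ => ⟨fun _ => ∅, by simp, by simp⟩
  | insert e I he ih =>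
    intro hS
    rw [card_insert_of_notMem he] at hS
    obtain ⟨h, h1, h2⟩ := ih fun e' he' =>
      (Nat.mul_le_mul_left t (Nat.le_succ _)).trans (hS e' (mem_insert_of_mem he'))
    have hU : #(I.biUnion h) ≤ #I * t :=
      card_biUnion_le_card_mul _ _ _ fun e' he' => (h1 e' he').2.le
    have hSe := hS e (mem_insert_self _ _)
    have hdiff : t ≤ #(S e \ I.biUnion h) := by
      have := le_card_sdiff (I.biUnion h) (S e)
      rw [mul_add, mul_comm t] at hSe
      omega
    obtain ⟨X, hX, hXc⟩ := exists_subset_card_eq hdiff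
    have hXd : ∀ e' ∈ I, Disjoint X (h e') := fun e' he' =>
      (disjoint_of_subset_left hX sdiff_disjoint).mono_right (subset_biUnion_of_mem h he')
    have hne : ∀ e' ∈ I, e' ≠ e := fun e' he' hh => he (hh ▸ he')
    refine ⟨Function.update h e X, ?_, ?_⟩
    · intro e' he'
      rcases mem_insert.1 he' with rfl | he'
      · simpa using ⟨hX.trans sdiff_subset, hXc⟩
      · simpa [hne e' he'] using h1 e' he'
    · intro e₁ he₁ e₂ he₂ h12
      rw [mem_insert] at he₁ he₂
      rcases he₁ with rfl | he₁ <;> rcases he₂ with rfl | he₂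
      · exact absurd rfl h12
      · simpa [hne e₂ he₂] using hXd e₂ he₂
      · simpa [hne e₁ he₁] using (hXd e₁ he₁).symm
      · simpa [hne e₁ he₁, hne e₂ he₂] using h2 e₁ he₁ e₂ he₂ h12

lemma cliqueCount_eq {V : Type*} [Fintype V] [DecidableEq V] (r : ℕ) (G : SimpleGraph V) :
    cliqueCount r G = cliquesIn G univ r := by
  classical
  unfold cliqueCount cliquesIn
  congr 1
  ext A
  simp only [SimpleGraph.mem_cliqueFinset_iff, SimpleGraph.isNClique_iff, mem_filter,
    mem_powersetCard, subset_univ, true_and]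
  exact and_comm

lemma edgeCount_eq {V : Type*} [Fintype V] [DecidableEq V] (G : SimpleGraph V) :
    edgeCount G = cliquesIn G univ 2 := by
  classical
  unfold edgeCount cliquesIn
  refine card_bij (fun e _ => e.toFinset) ?_ ?_ ?_
  · intro e he
    induction e with
    | _ x y =>
      have hxy : G.Adj x y := by simpa using he
      rw [Sym2.toFinset_mk_eq, mem_filter, mem_powersetCard]
      refine ⟨⟨subset_univ _, card_pair hxy.ne⟩, ?_⟩
      rw [coe_pair, SimpleGraph.isClique_pair]
      exact fun _ => hxy
  · intro e _ e' _ h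
    ext x
    rw [← Sym2.mem_toFinset, ← Sym2.mem_toFinset, h]
  · intro A hA
    obtain ⟨hA, hcl⟩ := mem_filter.1 hA
    obtain ⟨x, y, hxy, rfl⟩ := card_eq_two.1 (mem_powersetCard.1 hA).2
    rw [coe_pair, SimpleGraph.isClique_pair] at hcl
    exact ⟨s(x, y), by simpa using hcl hxy, Sym2.toFinset_mk_eq⟩

lemma card_mod_eq {n p i : ℕ} (hi : i < p) :
    #{x : Fin n | (x : ℕ) % p = i} = balancedSize n p i := by
  have h := Nat.count_modEq_card n (r := p) (by omega) i
  rw [Nat.mod_eq_of_lt hi, Nat.count_eq_card_filter_range] at h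
  rw [balancedSize, ← h, ← card_map Fin.valEmbedding]
  congr 1
  ext x
  simp only [mem_map, mem_filter, mem_univ, true_and, Fin.valEmbedding_apply, mem_range]
  unfold Nat.ModEq
  rw [Nat.mod_eq_of_lt hi]
  constructor
  · rintro ⟨y, hy, rfl⟩
    exact ⟨y.2, hy⟩
  · rintro ⟨hx, hxi⟩
    exact ⟨⟨x, hx⟩, hxi, rfl⟩

lemma card_rainbow_mod {n p : ℕ} (hp : 0 < p) (r : ℕ) :
    #((univ.powersetCard r).filter fun A : Finset (Fin n) =>
      Set.InjOn (fun x : Fin n => (x : ℕ) % p) (A : Set (Fin n))) = turanCliques n p r := by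
  classical
  have h := card_rainbow (fun x : Fin n => (x : ℕ) % p) univ (range p) r
  rw [elemSum_congr fun i hi => card_mod_eq (n := n) (mem_range.1 hi)] at h
  rw [turanCliques, ← h]
  congr 1
  ext A
  simp only [mem_filter]
  simp [Nat.mod_lt _ hp]

lemma exists_same_mod {n p : ℕ} (hp : 0 < p) (f : Fin (p + 1) ↪ Fin n) :
    ∃ x y, x ≠ y ∧ (f x : ℕ) % p = (f y : ℕ) % p := by
  obtain ⟨x, -, y, -, hxy, h⟩ := exists_ne_map_eq_of_card_lt_of_maps_to
    (s := (univ : Finset (Fin (p + 1)))) (t := range p) (f := fun x => (f x : ℕ) % p)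
    (by simp) (fun x _ => mem_coe.2 (mem_range.2 (Nat.mod_lt _ hp)))
  exact ⟨x, y, hxy, h⟩

lemma cliqueFree_of_not_graphContains {V : Type*} {p : ℕ} {G : SimpleGraph V}
    (h : ¬ GraphContains (⊤ : SimpleGraph (Fin p)) G) (A : Finset V) (hA : #A = p) :
    ¬ G.IsClique (A : Set V) := by
  intro hcl
  apply h
  let e := A.equivFinOfCardEq hA
  refine ⟨⟨fun i => (e.symm i : V), fun i j hij => e.symm.injective (Subtype.ext hij)⟩, ?_⟩
  intro x y hxy
  refine hcl (e.symm x).2 (e.symm y).2 fun hh => hxy ?_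
  exact e.symm.injective (Subtype.ext hh)

lemma exClique_eq {n p : ℕ} (hp : 0 < p) (r : ℕ) :
    exClique n r (⊤ : SimpleGraph (Fin (p + 1))) = turanCliques n p r := by
  have hub : ∀ m ∈ {m | ∃ G : SimpleGraph (Fin n),
      ¬ GraphContains (⊤ : SimpleGraph (Fin (p + 1))) G ∧ cliqueCount r G = m},
      m ≤ turanCliques n p r := by
    rintro m ⟨G, hG, rfl⟩
    rw [cliqueCount_eq]
    have := cliquesIn_le_turanCliques G p univ
      (fun A _ hA => cliqueFree_of_not_graphContains hG A hA) r
    rwa [card_univ, Fintype.card_fin] at this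
  refine le_antisymm (csSup_le' hub) (le_csSup ⟨_, hub⟩ ?_)
  let G : SimpleGraph (Fin n) :=
    { Adj := fun x y => (x : ℕ) % p ≠ (y : ℕ) % p
      symm := ⟨fun _ _ h => h.symm⟩
      loopless := ⟨fun _ h => h rfl⟩ }
  refine ⟨G, ?_, ?_⟩
  · rintro ⟨f, hf⟩
    obtain ⟨x, y, hxy, h⟩ := exists_same_mod hp f
    exact hf x y hxy h
  · rw [cliqueCount_eq, ← card_rainbow_mod hp]
    unfold cliquesIn
    congr 1
    ext A
    simp only [mem_filter]
    refine and_congr_right fun _ => ?_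
    constructor
    · intro h x hx y hy hxy
      by_contra hne
      exact h hx hy hne hxy
    · intro h x hx y hy hne hxy
      exact hne (h hx hy hxy)

lemma exTuran_eq {n p : ℕ} (hp : 0 < p) :
    exTuran n (⊤ : SimpleGraph (Fin (p + 1))) = turanCliques n p 2 := by
  rw [← exClique_eq hp, exTuran, exClique]
  simp only [edgeCount_eq, cliqueCount_eq]

lemma not_hasHeavyCopy_of_rainbow_union {n p t : ℕ} (hp : 0 < p) (ht : 1 ≤ t)
    {H : Finset (Finset (Fin n))} (P : Finset (Fin n) → Finset (Finset (Fin n)))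
    (hP : ∀ x y : Fin n, x ≠ y → (x : ℕ) % p = (y : ℕ) % p → #(P {x, y}) ≤ t - 1)
    (hH : ∀ A ∈ H, ∀ x ∈ A, ∀ y ∈ A, x ≠ y → (x : ℕ) % p = (y : ℕ) % p → A ∈ P {x, y}) :
    ¬ HasHeavyCopy H (⊤ : SimpleGraph (Fin (p + 1))) t := by
  rintro ⟨f, hf⟩
  obtain ⟨x, y, hxy, h⟩ := exists_same_mod hp f
  have h1 := hf x y hxy
  have hne : f x ≠ f y := fun hh => hxy (f.injective hh)
  have h2 := card_le_card (show H.filter (fun A => f x ∈ A ∧ f y ∈ A) ⊆ P {f x, f y} from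
    fun A hA => by
      obtain ⟨hA, hx, hy⟩ := mem_filter.1 hA
      exact hH A hA _ hx _ hy hne h)
  have h3 := hP _ _ hne h
  omega

/-- The extremal hypergraph. -/
lemma exists_heavyFree {n p r t : ℕ} (hr : 2 < r) (hrp : r ≤ p) (ht : 1 ≤ t) (hn : t ≤ n / p) :
    ∃ H : Finset (Finset (Fin n)), (∀ A ∈ H, #A = r) ∧
      ¬ HasHeavyCopy H (⊤ : SimpleGraph (Fin (p + 1))) t ∧
      #H = turanCliques n p r + (t - 1) * (n.choose 2 - turanCliques n p 2) := by
  classical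
  have hp : 0 < p := by omega
  set c : Fin n → ℕ := fun x => (x : ℕ) % p with hc
  set mono : Finset (Finset (Fin n)) := (univ.powersetCard 2).filter
    fun e : Finset (Fin n) => ¬ Set.InjOn c (e : Set (Fin n)) with hmono
  have hmono_card : #mono = n.choose 2 - turanCliques n p 2 := by
    have h := card_filter_add_card_filter_not (s := (univ : Finset (Fin n)).powersetCard 2)
      (fun e : Finset (Fin n) => Set.InjOn c (e : Set (Fin n)))
    rw [card_rainbow_mod hp, card_powersetCard, card_univ, Fintype.card_fin] at h
    rw [hmono]
    omega
  have hex : ∀ e : Finset (Fin n), ∃ X : Finset (Finset (Fin n)), e ∈ mono → #X = t - 1 ∧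
      ∀ A ∈ X, #A = r ∧ e ⊆ A ∧ ∀ x ∈ A, ∀ y ∈ A, x ≠ y → c x = c y → e = {x, y} := by
    intro e
    by_cases he : e ∈ mono
    swap
    · exact ⟨∅, fun h => absurd h he⟩
    obtain ⟨he2, hinj⟩ := mem_filter.1 he
    obtain ⟨u, v, huv, rfl⟩ := card_eq_two.1 (mem_powersetCard.1 he2).2
    have hcuv : c u = c v := by
      by_contra hne
      apply hinj
      rw [coe_pair]
      intro x hx y hy hxy
      rcases hx with rfl | rfl <;> rcases hy with rfl | rfl
      · rfl
      · exact absurd hxy hne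
      · exact absurd hxy.symm hne
      · rfl
    have hcu : c u ∈ range p := mem_range.2 (Nat.mod_lt _ hp)
    have hcard := card_rainbow c univ ((range p).erase (c u)) (r - 2)
    have hle : t - 1 ≤ elemSum ((range p).erase (c u))
        (fun i => #{x : Fin n | c x = i}) (r - 2) := by
      refine le_elemSum (by omega) ?_ fun i hi => ?_
      · rw [card_erase_of_mem hcu, card_range]; omega
      · rw [card_mod_eq (mem_range.1 (mem_of_mem_erase hi))]
        have := div_le_balancedSize n p i
        omega
    rw [← hcard] at hle
    obtain ⟨Y, hY, hYc⟩ := exists_subset_card_eq hle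
    have hYp : ∀ Q ∈ Y, #Q = r - 2 ∧ Set.InjOn c (Q : Set (Fin n)) ∧ ∀ x ∈ Q, c x ≠ c u := by
      intro Q hQ
      have h := hY hQ
      simp only [mem_filter] at h
      obtain ⟨h1, h2, h3⟩ := h
      exact ⟨(mem_powersetCard.1 h1).2, h2, fun x hx => (mem_erase.1 (h3 x hx)).1⟩
    have hdisj : ∀ Q ∈ Y, Disjoint {u, v} Q := by
      intro Q hQ
      rw [disjoint_left]
      intro x hx hxQ
      have h3 := (hYp Q hQ).2.2 x hxQ
      simp only [mem_insert, mem_singleton] at hx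
      rcases hx with rfl | rfl
      · exact h3 rfl
      · exact h3 hcuv.symm
    refine ⟨Y.image fun Q => {u, v} ∪ Q, fun _ => ⟨?_, ?_⟩⟩
    · rw [card_image_of_injOn, hYc]
      intro Q hQ Q' hQ' h
      rw [← union_sdiff_cancel_left (hdisj Q hQ), ← union_sdiff_cancel_left (hdisj Q' hQ')]
      exact congrArg (fun X => X \ {u, v}) h
    · intro A hA
      obtain ⟨Q, hQ, rfl⟩ := mem_image.1 hA
      obtain ⟨hQc, hQi, hQu⟩ := hYp Q hQ
      refine ⟨?_, subset_union_left, ?_⟩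
      · rw [card_union_of_disjoint (hdisj Q hQ), card_pair huv, hQc]; omega
      · intro x hx y hy hxy hcxy
        simp only [mem_union, mem_insert, mem_singleton] at hx hy
        rcases hx with (rfl | rfl) | hx <;> rcases hy with (rfl | rfl) | hy
        · exact absurd rfl hxy
        · rfl
        · exact absurd hcxy.symm (hQu y hy)
        · exact pair_comm _ _
        · exact absurd rfl hxy
        · exact absurd (hcxy.symm.trans hcuv.symm) (hQu y hy)
        · exact absurd hcxy (hQu x hx)
        · exact absurd (hcxy.trans hcuv.symm) (hQu x hx)
        · exact absurd (hQi hx hy hcxy) hxy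
  choose X hX using hex
  have hpair : ∀ x y : Fin n, x ≠ y → c x = c y → {x, y} ∈ mono := by
    intro x y hxy hcxy
    refine mem_filter.2 ⟨mem_powersetCard.2 ⟨subset_univ _, card_pair hxy⟩, fun h => hxy ?_⟩
    exact h (by simp) (by simp) hcxy
  have hmono_ex : ∀ e ∈ mono, ∃ x ∈ e, ∃ y ∈ e, x ≠ y ∧ c x = c y := by
    intro e he
    have h := (mem_filter.1 he).2
    unfold Set.InjOn at h
    push Not at h
    obtain ⟨x, hx, y, hy, hcxy, hxy⟩ := h
    exact ⟨x, hx, y, hy, hxy, hcxy⟩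
  set R : Finset (Finset (Fin n)) := (univ.powersetCard r).filter
    fun A : Finset (Fin n) => Set.InjOn c (A : Set (Fin n)) with hR
  refine ⟨R ∪ mono.biUnion X, ?_, ?_, ?_⟩
  · intro A hA
    rcases mem_union.1 hA with hA | hA
    · exact (mem_powersetCard.1 (mem_filter.1 hA).1).2
    · obtain ⟨e, he, hA⟩ := mem_biUnion.1 hA
      exact ((hX e he).2 A hA).1
  · refine not_hasHeavyCopy_of_rainbow_union hp ht X
      (fun x y hxy h => (hX _ (hpair x y hxy h)).1.le) ?_
    intro A hA x hx y hy hxy hcxy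
    rcases mem_union.1 hA with hA | hA
    · exact absurd ((mem_filter.1 hA).2 hx hy hcxy) hxy
    · obtain ⟨e, he, hA⟩ := mem_biUnion.1 hA
      rw [← ((hX e he).2 A hA).2.2 x hx y hy hxy hcxy]
      exact hA
  · rw [card_union_of_disjoint, card_biUnion, sum_congr rfl fun e he => (hX e he).1, sum_const,
      smul_eq_mul, hmono_card, hR, card_rainbow_mod hp, mul_comm]
    · intro e he e' he' hne
      refine disjoint_left.2 ?_
      intro A hA hA'
      obtain ⟨x, hx, y, hy, hxy, hcxy⟩ := hmono_ex e he
      obtain ⟨-, heA, h1⟩ := (hX e he).2 A hA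
      exact hne ((h1 x (heA hx) y (heA hy) hxy hcxy).trans
        (((hX e' he').2 A hA').2.2 x (heA hx) y (heA hy) hxy hcxy).symm)
    · rw [disjoint_left]
      intro A hA hA'
      obtain ⟨e, he, hA'⟩ := mem_biUnion.1 hA'
      obtain ⟨x, hx, y, hy, hxy, hcxy⟩ := hmono_ex e he
      obtain ⟨-, heA, -⟩ := (hX e he).2 A hA'
      exact hxy ((mem_filter.1 hA).2 (heA hx) (heA hy) hcxy)

section Heavy

variable {V : Type*} [DecidableEq V]

/-- The number of members of `H` containing both `u` and `v`. -/
def codegree (H : Finset (Finset V)) (u v : V) : ℕ := #{A ∈ H | u ∈ A ∧ v ∈ A}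

lemma codegree_comm (H : Finset (Finset V)) (u v : V) : codegree H u v = codegree H v u := by
  unfold codegree
  simp only [and_comm]

/-- The graph of the pairs contained in at least `M` members of `H`. -/
def heavyGraph (H : Finset (Finset V)) (M : ℕ) : SimpleGraph V where
  Adj u v := u ≠ v ∧ M ≤ codegree H u v
  symm := ⟨fun u v h => ⟨h.1.symm, codegree_comm H u v ▸ h.2⟩⟩
  loopless := ⟨fun _ h => h.1 rfl⟩

lemma hasBergeCopy_of_codegree {H : Finset (Finset V)} {k t M : ℕ}
    (hM : t * Fintype.card (Sym2 (Fin k)) ≤ M) (f : Fin k ↪ V) (x₀ y₀ : Fin k)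
    (h₀ : t ≤ codegree H (f x₀) (f y₀))
    (h : ∀ x y, x ≠ y → s(x, y) ≠ s(x₀, y₀) → M ≤ codegree H (f x) (f y)) :
    HasBergeCopy H (⊤ : SimpleGraph (Fin k)) t := by
  classical
  set S : Sym2 (Fin k) → Finset (Finset V) := fun e => {A ∈ H | ∀ x ∈ e, f x ∈ A} with hS
  have hSc : ∀ x y, #(S s(x, y)) = codegree H (f x) (f y) := fun x y => by
    simp [hS, codegree]
  set e₀ : Sym2 (Fin k) := s(x₀, y₀) with he₀
  obtain ⟨X, hXS, hXc⟩ := exists_subset_card_eq (h₀.trans_eq (hSc x₀ y₀).symm)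
  set I : Finset (Sym2 (Fin k)) := {e ∈ univ.erase e₀ | ¬ e.IsDiag} with hI
  have hIc : #I + 1 ≤ Fintype.card (Sym2 (Fin k)) := by
    have h1 : #I ≤ #(univ.erase e₀) := card_filter_le _ _
    have h2 : #(univ.erase e₀) + 1 = #(univ : Finset (Sym2 (Fin k))) :=
      card_erase_add_one (mem_univ e₀)
    rw [card_univ] at h2
    omega
  obtain ⟨g, hg1, hg2⟩ := exists_disjoint_subsets t (fun e => S e \ X) I (by
    intro e he
    obtain ⟨he, hd⟩ := mem_filter.1 he
    have hne := (mem_erase.1 he).1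
    induction e with
    | _ x y =>
      have h1 := h x y (by simpa using hd) hne
      have h2 := le_card_sdiff X (S s(x, y))
      have h3 := Nat.mul_le_mul_left t hIc
      rw [hSc] at h2
      rw [mul_add] at h3
      omega)
  have hmem : ∀ e ∈ (⊤ : SimpleGraph (Fin k)).edgeSet, e ≠ e₀ → e ∈ I := by
    intro e he hne
    exact mem_filter.2 ⟨mem_erase.2 ⟨hne, mem_univ _⟩, SimpleGraph.not_isDiag_of_mem_edgeSet _ he⟩
  have hgX : ∀ e ∈ I, Disjoint X (g e) := fun e he =>
    disjoint_of_subset_right (hg1 e he).1 disjoint_sdiff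
  refine ⟨f, Function.update g e₀ X, ?_, ?_⟩
  · intro e he
    have hsub : Function.update g e₀ X e ⊆ S e ∧ #(Function.update g e₀ X e) = t := by
      by_cases hne : e = e₀
      · subst hne
        simpa using ⟨hXS, hXc⟩
      · have := hg1 e (hmem e he hne)
        simpa [hne] using ⟨this.1.trans sdiff_subset, this.2⟩
    exact ⟨hsub.1.trans (filter_subset _ _), hsub.2,
      fun A hA => (mem_filter.1 (hsub.1 hA)).2⟩
  · intro e he e' he' hne
    by_cases h1 : e = e₀ <;> by_cases h2 : e' = e₀
    · exact absurd (h1.trans h2.symm) hne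
    · subst h1
      simpa [h2] using hgX e' (hmem e' he' h2)
    · subst h2
      simpa [h1] using (hgX e (hmem e he h1)).symm
    · simpa [h1, h2] using hg2 e (hmem e he h1) e' (hmem e' he' h2) hne

lemma heavyGraph_cliqueFree {H : Finset (Finset V)} {k t M : ℕ} (hk : 2 ≤ k)
    (hM : t * Fintype.card (Sym2 (Fin k)) ≤ M)
    (hH : ¬ HasBergeCopy H (⊤ : SimpleGraph (Fin k)) t) (A : Finset V) (hA : #A = k) :
    ¬ (heavyGraph H M).IsClique (A : Set V) := by
  refine cliqueFree_of_not_graphContains ?_ A hA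
  rintro ⟨f, hf⟩
  apply hH
  have h : ∀ x y, x ≠ y → M ≤ codegree H (f x) (f y) := fun x y hxy => (hf x y hxy).2
  refine hasBergeCopy_of_codegree hM f ⟨0, by omega⟩ ⟨1, by omega⟩ ?_ fun x y hxy _ => h x y hxy
  refine le_trans ?_ (h _ _ (by simp))
  refine le_trans ?_ hM
  have : Nonempty (Sym2 (Fin k)) := ⟨s(⟨0, by omega⟩, ⟨0, by omega⟩)⟩
  exact Nat.le_mul_of_pos_right _ Fintype.card_pos

open Classical in
/-- Greedy choice of a clique with prescribed neighbours `U` and one vertex in each class. -/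
lemma exists_transversal_clique (G : SimpleGraph V) (C : ℕ → Finset V) (U : Finset V) (m : ℕ)
    (hU : U.Nonempty) (J : Finset ℕ) :
    (∀ j ∈ J, ∀ u ∈ U, #{y ∈ C j | ¬ G.Adj u y} ≤ m) →
    (∀ i ∈ J, ∀ j ∈ J, i ≠ j → ∀ x ∈ C i, #{y ∈ C j | ¬ G.Adj x y} ≤ m) →
    (∀ j ∈ J, (#U + #J) * m < #(C j)) →
    ∃ x : ℕ → V, ∀ j ∈ J, x j ∈ C j ∧ (∀ u ∈ U, G.Adj u (x j)) ∧
      ∀ i ∈ J, i ≠ j → G.Adj (x i) (x j) := by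
  induction J using Finset.induction_on with
  | empty =>
    obtain ⟨u, -⟩ := hU
    exact fun _ _ _ => ⟨fun _ => u, by simp⟩
  | insert j J hj ih =>
    intro h1 h2 h3
    rw [card_insert_of_notMem hj] at h3
    obtain ⟨x, hx⟩ := ih (fun i hi => h1 i (mem_insert_of_mem hi))
      (fun i hi i' hi' => h2 i (mem_insert_of_mem hi) i' (mem_insert_of_mem hi'))
      (fun i hi => lt_of_le_of_lt (Nat.mul_le_mul_right m (by omega))
        (h3 i (mem_insert_of_mem hi)))
    set Y := U ∪ J.image x with hY
    have hYc : #Y ≤ #U + #J := (card_union_le _ _).trans (Nat.add_le_add_left card_image_le _)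
    have hYm : ∀ z ∈ Y, #{y ∈ C j | ¬ G.Adj z y} ≤ m := by
      intro z hz
      rcases mem_union.1 hz with hz | hz
      · exact h1 j (mem_insert_self _ _) z hz
      · obtain ⟨i, hi, rfl⟩ := mem_image.1 hz
        exact h2 i (mem_insert_of_mem hi) j (mem_insert_self _ _)
          (fun h => hj (h ▸ hi)) _ (hx i hi).1
    have hbad : #(Y.biUnion fun z => {y ∈ C j | ¬ G.Adj z y}) < #(C j) := by
      refine lt_of_le_of_lt (card_biUnion_le_card_mul _ _ _ hYm) ?_
      refine lt_of_le_of_lt (Nat.mul_le_mul_right m ?_) (h3 j (mem_insert_self _ _))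
      omega
    obtain ⟨y, hyC, hy⟩ := exists_mem_notMem_of_card_lt_card hbad
    have hadj : ∀ z ∈ Y, G.Adj z y := by
      intro z hz
      by_contra hne
      exact hy (mem_biUnion.2 ⟨z, hz, mem_filter.2 ⟨hyC, hne⟩⟩)
    have hne : ∀ i ∈ J, i ≠ j := fun i hi h => hj (h ▸ hi)
    refine ⟨Function.update x j y, ?_⟩
    intro i hi
    rcases mem_insert.1 hi with rfl | hiJ
    · refine ⟨by simpa using hyC, fun u hu => by simpa using hadj u (mem_union_left _ hu), ?_⟩
      intro i' hi' hii'
      have hi'J := (mem_insert.1 hi').resolve_left hii'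
      simpa [hii'] using hadj _ (mem_union_right _ (mem_image_of_mem x hi'J))
    · have hij := hne i hiJ
      refine ⟨by simpa [hij] using (hx i hiJ).1, by simpa [hij] using (hx i hiJ).2.1, ?_⟩
      intro i' hi' hii'
      rcases mem_insert.1 hi' with rfl | hi'
      · simpa [hij] using (hadj _ (mem_union_right _ (mem_image_of_mem x hiJ))).symm
      · simpa [hij, hne i' hi'] using (hx i hiJ).2.2 i' hi' hii'

open Classical in
/-- In a nearly complete multipartite heavy graph, pairs inside a class have small codegree. -/
lemma codegree_lt_of_same_class {H : Finset (Finset V)} {p t M m : ℕ}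
    (hM : t * Fintype.card (Sym2 (Fin (p + 1))) ≤ M)
    (hH : ¬ HasBergeCopy H (⊤ : SimpleGraph (Fin (p + 1))) t) (W : Finset V) (c : V → ℕ)
    (hmiss : ∀ x ∈ W, ∀ j < p, j ≠ c x →
      #{y ∈ {w ∈ W | c w = j} | ¬ (heavyGraph H M).Adj x y} ≤ m)
    (hbig : ∀ j < p, (p + 1) * m < #{w ∈ W | c w = j})
    {u v : V} (hu : u ∈ W) (hv : v ∈ W) (huv : u ≠ v) (hcuv : c u = c v) (hcp : c u < p) :
    codegree H u v < t := by
  by_contra! ht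
  apply hH
  set G := heavyGraph H M with hG
  obtain ⟨x, hx⟩ := exists_transversal_clique G (fun j => {w ∈ W | c w = j}) {u, v} m
    (insert_nonempty _ _) ((range p).erase (c u))
    (by
      intro j hj z hz
      obtain ⟨hj, hjp⟩ := mem_erase.1 hj
      simp only [mem_insert, mem_singleton] at hz
      rcases hz with rfl | rfl
      · exact hmiss _ hu j (mem_range.1 hjp) hj
      · exact hmiss _ hv j (mem_range.1 hjp) (hcuv ▸ hj))
    (by
      intro i hi j hj hij z hz
      obtain ⟨hzW, hzi⟩ := mem_filter.1 hz
      exact hmiss z hzW j (mem_range.1 (mem_of_mem_erase hj)) (hzi ▸ hij.symm))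
    (by
      intro j hj
      have h1 : #({u, v} : Finset V) + #((range p).erase (c u)) = p + 1 := by
        rw [card_pair huv, card_erase_of_mem (mem_range.2 hcp), card_range]; omega
      rw [h1]
      exact hbig j (mem_range.1 (mem_of_mem_erase hj)))
  set f : ℕ → V := fun i => if i = p then v else if i = c u then u else x i with hf
  have fp : f p = v := by simp [hf]
  have fc : f (c u) = u := by simp [hf, hcp.ne]
  have fx : ∀ i, i ≠ p → i ≠ c u → f i = x i := fun i h1 h2 => by simp [hf, h1, h2]
  have hJ : ∀ i, i ≤ p → i ≠ p → i ≠ c u → i ∈ (range p).erase (c u) := fun i h1 h2 h3 =>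
    mem_erase.2 ⟨h3, mem_range.2 (by omega)⟩
  have hadj : ∀ i ≤ p, ∀ j ≤ p, i ≠ j → s(i, j) ≠ s(c u, p) → G.Adj (f i) (f j) := by
    intro i hi j hj hij hs
    have key : ∀ i j, i ≤ p → j ≤ p → i ≠ j → s(i, j) ≠ s(c u, p) → j ≠ p → j ≠ c u →
        G.Adj (f i) (f j) := by
      intro i j hi hj hij hs h1 h2
      have hjJ := hx j (hJ j hj h1 h2)
      rw [fx j h1 h2]
      by_cases h3 : i = p
      · rw [h3, fp]
        exact hjJ.2.1 v (by simp)
      by_cases h4 : i = c u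
      · rw [h4, fc]
        exact hjJ.2.1 u (by simp)
      rw [fx i h3 h4]
      exact hjJ.2.2 i (hJ i hi h3 h4) hij
    by_cases h1 : j ≠ p ∧ j ≠ c u
    · exact key i j hi hj hij hs h1.1 h1.2
    by_cases h2 : i ≠ p ∧ i ≠ c u
    · exact (key j i hj hi hij.symm (by rwa [Sym2.eq_swap]) h2.1 h2.2).symm
    exfalso
    apply hs
    rw [Sym2.eq_iff]
    omega
  have hinj : ∀ i ≤ p, ∀ j ≤ p, f i = f j → i = j := by
    intro i hi j hj hij
    by_contra hne
    by_cases hs : s(i, j) = s(c u, p)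
    · rcases Sym2.eq_iff.1 hs with ⟨rfl, rfl⟩ | ⟨rfl, rfl⟩
      · exact huv (fc.symm.trans (hij.trans fp))
      · exact huv (fc.symm.trans (hij.symm.trans fp))
    · exact (hadj i hi j hj hne hs).ne hij
  refine hasBergeCopy_of_codegree hM
    ⟨fun i : Fin (p + 1) => f i, fun i j hij => Fin.ext
      (hinj i (Nat.lt_succ_iff.1 i.2) j (Nat.lt_succ_iff.1 j.2) hij)⟩
    ⟨c u, by omega⟩ ⟨p, by omega⟩ ?_ ?_
  · change t ≤ codegree H (f (c u)) (f p)
    rw [fc, fp]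
    exact ht
  · intro i j hij hs
    refine (hadj i (Nat.lt_succ_iff.1 i.2) j (Nat.lt_succ_iff.1 j.2)
      (fun h => hij (Fin.ext h)) fun h => hs ?_).2
    rw [Sym2.eq_iff] at h ⊢
    simpa [Fin.ext_iff] using h

end Heavy

section Counting

variable {V : Type*} [DecidableEq V]

lemma cliquesIn_one_le (G : SimpleGraph V) (W : Finset V) : cliquesIn G W 1 ≤ #W := by
  classical
  unfold cliquesIn
  exact (card_filter_le _ _).trans (by simp)

lemma cliquesIn_nbrsIn_le {G : SimpleGraph V} {p : ℕ} (hp : 0 < p)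
    (hfree : ∀ A : Finset V, #A = p + 1 → ¬ G.IsClique (A : Set V)) (W : Finset V) (v : V) (s : ℕ) :
    cliquesIn G (nbrsIn G W v) s ≤ turanCliques #(nbrsIn G W v) (p - 1) s := by
  classical
  refine cliquesIn_le_turanCliques G (p - 1) _ (fun A hA hAc hcl => ?_) s
  have hadj : ∀ u ∈ A, G.Adj v u := fun u hu => (mem_filter.1 (hA hu)).2
  refine hfree (insert v A) ?_ ?_
  · rw [card_insert_of_notMem fun h => (hadj v h).ne rfl]
    omega
  · rw [coe_insert]
    exact hcl.insert fun u hu _ => hadj u hu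

/-- A hyperedge that is not a clique of the heavy graph contains a light pair. -/
lemma exists_light_pair {H : Finset (Finset V)} {M : ℕ} {A : Finset V}
    (hA : ¬ (heavyGraph H M).IsClique (A : Set V)) :
    ∃ u ∈ A, ∃ v ∈ A, u ≠ v ∧ codegree H u v < M := by
  simp only [SimpleGraph.IsClique, Set.Pairwise, heavyGraph] at hA
  push Not at hA
  obtain ⟨u, hu, v, hv, huv, h⟩ := hA
  exact ⟨u, hu, v, hv, huv, h huv⟩

open Classical in
/-- The nonadjacent pairs of `W` with endpoints in different classes of `c`. -/
noncomputable def missingPairs (G : SimpleGraph V) (W : Finset V) (c : V → ℕ) :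
    Finset (Finset V) :=
  (W.powersetCard 2).filter fun A => Set.InjOn c (A : Set V) ∧ ¬ G.IsClique (A : Set V)

lemma card_missingPairs_add_le {G : SimpleGraph V} {W : Finset V} {c : V → ℕ} {p : ℕ}
    (hcp : ∀ x ∈ W, c x < p) (hc : ∀ x ∈ W, ∀ y ∈ W, c x = c y → ¬ G.Adj x y) :
    #(missingPairs G W c) + cliquesIn G W 2 ≤
      elemSum (range p) (fun i => #{x ∈ W | c x = i}) 2 := by
  classical
  have h := card_rainbow c W (range p) 2
  rw [cliquesIn, missingPairs, ← card_union_of_disjoint]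
  · refine le_trans (card_le_card ?_) h.le
    intro A hA
    rcases mem_union.1 hA with hA | hA
    · obtain ⟨hA, hi, -⟩ := mem_filter.1 hA
      exact mem_filter.2 ⟨hA, hi, fun x hx => mem_range.2 (hcp x ((mem_powersetCard.1 hA).1 hx))⟩
    · obtain ⟨hA, hi⟩ := mem_filter.1 hA
      have hAW := (mem_powersetCard.1 hA).1
      refine mem_filter.2 ⟨hA, fun x hx y hy hxy => ?_,
        fun x hx => mem_range.2 (hcp x (hAW hx))⟩
      by_contra hne
      exact hc x (hAW hx) y (hAW hy) hxy (hi hx hy hne)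
  · refine disjoint_left.2 fun A hA hA' => ?_
    exact (mem_filter.1 hA).2.2 (mem_filter.1 hA').2

/-- The number of monochromatic pairs. -/
lemma card_mono_pairs {W : Finset V} {c : V → ℕ} (p : ℕ)
    (Q : Finset (Finset V)) (hQ : ∀ A ∈ Q, A ∈ W.powersetCard 2 ∧ ¬ Set.InjOn c (A : Set V)) :
    #Q + elemSum (range p) (fun i => #{x ∈ W | c x = i}) 2 ≤ (#W).choose 2 := by
  classical
  rw [← card_rainbow c W (range p) 2, ← card_powersetCard, ← card_union_of_disjoint]
  · refine card_le_card fun A hA => ?_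
    rcases mem_union.1 hA with hA | hA
    · exact (hQ A hA).1
    · exact (mem_filter.1 hA).1
  · refine disjoint_left.2 fun A hA hA' => ?_
    exact (hQ A hA).2 (mem_filter.1 hA').2.1

variable [Fintype V]

lemma sum_card_nbrsIn (G : SimpleGraph V) :
    ∑ v, #(nbrsIn G univ v) = 2 * cliquesIn G univ 2 := by
  classical
  rw [← edgeCount_eq, edgeCount]
  rw [← SimpleGraph.sum_degrees_eq_twice_card_edges]
  refine sum_congr rfl fun v _ => ?_
  rw [← SimpleGraph.card_neighborFinset_eq_degree]
  congr 1
  ext u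
  simp [nbrsIn]

lemma card_le_cliquesIn_add {H : Finset (Finset V)} {r : ℕ} (hH : ∀ A ∈ H, #A = r) (M : ℕ) :
    #H ≤ cliquesIn (heavyGraph H M) univ r + M * Fintype.card V ^ 2 := by
  classical
  set P : Finset (V × V) := {q | codegree H q.1 q.2 < M} with hP
  have hsub : H ⊆ ((univ.powersetCard r).filter fun A : Finset V =>
      (heavyGraph H M).IsClique (A : Set V)) ∪
      P.biUnion fun q => {A ∈ H | q.1 ∈ A ∧ q.2 ∈ A} := by
    intro A hA
    by_cases hc : (heavyGraph H M).IsClique (A : Set V)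
    · exact mem_union_left _ (mem_filter.2 ⟨mem_powersetCard.2 ⟨subset_univ _, hH A hA⟩, hc⟩)
    · obtain ⟨u, hu, v, hv, -, h⟩ := exists_light_pair hc
      exact mem_union_right _ (mem_biUnion.2
        ⟨(u, v), mem_filter.2 ⟨mem_univ _, h⟩, mem_filter.2 ⟨hA, hu, hv⟩⟩)
  refine (card_le_card hsub).trans ((card_union_le _ _).trans (Nat.add_le_add le_rfl ?_))
  refine (card_biUnion_le_card_mul _ _ M fun q hq => (mem_filter.1 hq).2.le).trans ?_
  rw [mul_comm]
  refine Nat.mul_le_mul_left _ ?_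
  refine (card_le_univ _).trans ?_
  simp [sq]

open Classical in
/-- Counting the hyperedges relative to a colouring `c` of the complement of `B`. -/
lemma card_le_of_coloring {H : Finset (Finset V)} {r p l M : ℕ} (hH : ∀ A ∈ H, #A = r + 1)
    (B : Finset V) (c : V → ℕ) (hcp : ∀ x ∈ univ \ B, c x < p)
    (hcod : ∀ x ∈ univ \ B, ∀ y ∈ univ \ B, x ≠ y → c x = c y → codegree H x y ≤ l) :
    #H ≤ l * ((#(univ \ B)).choose 2 -
        elemSum (range p) (fun i => #{x ∈ univ \ B | c x = i}) 2) +
      elemSum (range p) (fun i => #{x ∈ univ \ B | c x = i}) (r + 1) +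
      ∑ v ∈ B, cliquesIn (heavyGraph H M) (nbrsIn (heavyGraph H M) univ v) r +
      #B * Fintype.card V * M + #B * #(missingPairs (heavyGraph H M) (univ \ B) c) * M := by
  set G := heavyGraph H M with hG
  set W := univ \ B with hW
  set Q : Finset (Finset V) := (W.powersetCard 2).filter fun A => ¬ Set.InjOn c (A : Set V) with hQ
  have hQc := card_mono_pairs p Q fun A hA => mem_filter.1 hA
  have hpair : ∀ x y : V, #{A ∈ H | {x, y} ⊆ A} = codegree H x y := fun x y => by
    unfold codegree
    congr 1
    ext A
    simp [insert_subset_iff]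
  set S₁ := Q.biUnion fun P => {A ∈ H | P ⊆ A} with hS₁
  set S₂ := (W.powersetCard (r + 1)).filter fun A : Finset V =>
    Set.InjOn c (A : Set V) ∧ ∀ x ∈ A, c x ∈ range p with hS₂
  set S₃ := ((univ : Finset V).powersetCard (r + 1)).filter fun A : Finset V =>
    G.IsClique (A : Set V) ∧ ¬ Disjoint A B with hS₃
  set S₄ := ((B ×ˢ (univ : Finset V)).filter fun q => codegree H q.1 q.2 < M).biUnion
    fun q => {A ∈ H | q.1 ∈ A ∧ q.2 ∈ A} with hS₄
  set S₅ := (B ×ˢ missingPairs G W c).biUnion fun q => {A ∈ H | q.1 ∈ A ∧ q.2 ⊆ A} with hS₅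
  have h1 : #S₁ ≤ l * ((#W).choose 2 - elemSum (range p) (fun i => #{x ∈ W | c x = i}) 2) := by
    refine (card_biUnion_le_card_mul _ _ l fun P hP => ?_).trans ?_
    · obtain ⟨hP, hi⟩ := mem_filter.1 hP
      obtain ⟨hPW, hP2⟩ := mem_powersetCard.1 hP
      obtain ⟨x, y, hxy, rfl⟩ := card_eq_two.1 hP2
      rw [hpair]
      refine hcod x (hPW (by simp)) y (hPW (by simp)) hxy ?_
      by_contra hne
      apply hi
      simp [hne]
    · rw [mul_comm]
      exact Nat.mul_le_mul_left _ (by omega)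
  have h2 : #S₂ = elemSum (range p) (fun i => #{x ∈ W | c x = i}) (r + 1) :=
    by convert card_rainbow c W (range p) (r + 1)
  have h3 : #S₃ ≤ ∑ v ∈ B, cliquesIn G (nbrsIn G univ v) r := card_cliques_meeting_le G univ B r
  have h4 : #S₄ ≤ #B * Fintype.card V * M := by
    refine (card_biUnion_le_card_mul _ _ M fun q hq => (mem_filter.1 hq).2.le).trans ?_
    refine Nat.mul_le_mul_right _ ((card_filter_le _ _).trans ?_)
    rw [card_product, card_univ]
  have h5 : #S₅ ≤ #B * #(missingPairs G W c) * M := by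
    rw [← card_product]
    refine card_biUnion_le_card_mul _ _ M fun q hq => ?_
    obtain ⟨hP, -, hcl⟩ := mem_filter.1 (mem_product.1 hq).2
    obtain ⟨x, y, hxy, hq2⟩ := card_eq_two.1 (mem_powersetCard.1 hP).2
    have hlight : codegree H x y ≤ M := by
      by_contra! hlt
      apply hcl
      rw [hq2, coe_pair]
      exact SimpleGraph.isClique_pair.2 fun _ => ⟨hxy, hlt.le⟩
    refine le_trans (card_le_card ?_) ((hpair x y).trans_le hlight)
    intro A hA
    obtain ⟨hA, -, hs⟩ := mem_filter.1 hA
    exact mem_filter.2 ⟨hA, hq2 ▸ hs⟩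
  have hsub : H ⊆ S₁ ∪ S₂ ∪ S₃ ∪ S₄ ∪ S₅ := by
    intro A hA
    simp only [mem_union]
    have hWB : ∀ x, x ∈ W ↔ x ∉ B := by simp [hW]
    by_cases hmono : ∃ x ∈ A, ∃ y ∈ A, x ∈ W ∧ y ∈ W ∧ x ≠ y ∧ c x = c y
    · obtain ⟨x, hx, y, hy, hxW, hyW, hxy, hcxy⟩ := hmono
      refine Or.inl (Or.inl (Or.inl (Or.inl (mem_biUnion.2 ⟨{x, y}, ?_, ?_⟩))))
      · refine mem_filter.2 ⟨mem_powersetCard.2 ⟨?_, card_pair hxy⟩, fun h => hxy ?_⟩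
        · simp [insert_subset_iff, hxW, hyW]
        · exact h (by simp) (by simp) hcxy
      · exact mem_filter.2 ⟨hA, by simp [insert_subset_iff, hx, hy]⟩
    · push Not at hmono
      by_cases hdis : Disjoint A B
      · have hAW : ∀ x ∈ A, x ∈ W := fun x hx => (hWB x).2 (disjoint_left.1 hdis hx)
        refine Or.inl (Or.inl (Or.inl (Or.inr (mem_filter.2
          ⟨mem_powersetCard.2 ⟨hAW, hH A hA⟩, fun x hx y hy hxy => ?_,
            fun x hx => mem_range.2 (hcp x (hAW x hx))⟩))))
        by_contra hne
        exact hmono x hx y hy (hAW x hx) (hAW y hy) hne hxy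
      · by_cases hcl : G.IsClique (A : Set V)
        · exact Or.inl (Or.inl (Or.inr (mem_filter.2
            ⟨mem_powersetCard.2 ⟨subset_univ _, hH A hA⟩, hcl, hdis⟩)))
        · obtain ⟨x, hx, y, hy, hxy, hlt⟩ := exists_light_pair hcl
          by_cases hxB : x ∈ B
          · exact Or.inl (Or.inr (mem_biUnion.2 ⟨(x, y), mem_filter.2
              ⟨mem_product.2 ⟨hxB, mem_univ _⟩, hlt⟩, mem_filter.2 ⟨hA, hx, hy⟩⟩))
          by_cases hyB : y ∈ B
          · exact Or.inl (Or.inr (mem_biUnion.2 ⟨(y, x), mem_filter.2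
              ⟨mem_product.2 ⟨hyB, mem_univ _⟩, by rwa [codegree_comm]⟩,
                mem_filter.2 ⟨hA, hy, hx⟩⟩))
          obtain ⟨z, hzA, hzB⟩ := not_disjoint_iff.1 hdis
          have hne := hmono x hx y hy ((hWB x).2 hxB) ((hWB y).2 hyB) hxy
          refine Or.inr (mem_biUnion.2 ⟨(z, {x, y}), mem_product.2 ⟨hzB, mem_filter.2
            ⟨mem_powersetCard.2 ⟨?_, card_pair hxy⟩, ?_, ?_⟩⟩,
              mem_filter.2 ⟨hA, hzA, by simp [insert_subset_iff, hx, hy]⟩⟩)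
          · simp [insert_subset_iff, hWB, hxB, hyB]
          · simp [hne]
          · rw [coe_pair, SimpleGraph.isClique_pair]
            exact fun h => absurd (h hxy).2 (not_le.2 hlt)
  have h6 := (card_le_card hsub).trans (card_union_le _ _)
  have h7 := card_union_le (S₁ ∪ S₂ ∪ S₃) S₄
  have h8 := card_union_le (S₁ ∪ S₂) S₃
  have h9 := card_union_le S₁ S₂
  omega

end Counting

lemma eventually_le_natCast (C : ℝ) : ∀ᶠ n : ℕ in Filter.atTop, C ≤ (n : ℝ) :=
  tendsto_natCast_atTop_atTop.eventually_ge_atTop C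

/-- A vertex of small degree lies in far fewer cliques than a vertex of the Turán graph. -/
lemma eventually_turanCliques_add_le {p r : ℕ} (hr : 2 < r) (hrp : r ≤ p) {ε : ℝ} (hε : 0 < ε)
    (S : ℕ) : ∀ᶠ n : ℕ in Filter.atTop, ∀ d b : ℕ, b ≤ S → (d : ℝ) ≤ (1 - 1 / p - ε) * n →
      (turanCliques d (p - 1) (r - 1) : ℝ) + ε / (4 * p ^ 2) * n ^ 2 ≤
        ((p - 1).choose (r - 1) * ((n - b) / p) ^ (r - 1) : ℕ) := by
  have hp3 : (3 : ℝ) ≤ p := by exact_mod_cast (by omega : 3 ≤ p)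
  have hp0 : (0 : ℝ) < p := by linarith
  filter_upwards [eventually_le_natCast (2 * p / ε * (S + 2)), eventually_le_natCast (2 * (S + p)),
    eventually_le_natCast S] with n hn1 hn2 hn3 d b hb hd
  have hn0 : (0 : ℝ) ≤ n := Nat.cast_nonneg n
  have hS0 : (0 : ℝ) ≤ S := Nat.cast_nonneg S
  obtain ⟨q, rfl⟩ : ∃ q, r = q + 3 := ⟨r - 3, by omega⟩
  have hq : q + 3 - 1 = q + 1 + 1 := by omega
  rw [hq]
  have hpc : ((p - 1 : ℕ) : ℝ) = p - 1 := by
    rw [Nat.cast_sub (by omega), Nat.cast_one]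
  set x : ℝ := (((n - b) / p : ℕ) : ℝ) with hx
  set y : ℝ := (d : ℝ) / (p - 1) + 1 with hy
  have hy0 : 0 ≤ y := by
    have : (0 : ℝ) ≤ (d : ℝ) / (p - 1) := div_nonneg (Nat.cast_nonneg d) (by linarith)
    linarith
  have hxl : (n : ℝ) / p - S / p - 1 ≤ x := by
    have hbn : b ≤ n := hb.trans (by exact_mod_cast hn3)
    have h1 := Nat.lt_div_mul_add (a := n - b) (b := p) (by omega)
    have h2 : ((n : ℝ) - b) < x * p + p := by
      have : ((n - b : ℕ) : ℝ) < (((n - b) / p * p + p : ℕ) : ℝ) := by exact_mod_cast h1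
      rw [Nat.cast_sub hbn] at this
      push_cast at this
      exact this
    have h3 : (b : ℝ) ≤ S := by exact_mod_cast hb
    have h4 : (n : ℝ) / p - S / p - 1 = (n - S - p) / p := by field_simp
    rw [h4, div_le_iff₀ hp0]
    linarith
  have hyu : y ≤ n / p - ε * n / p + 1 := by
    have h1 : (d : ℝ) / (p - 1) ≤ n / p - ε * n / p := by
      rw [div_le_iff₀ (by linarith)]
      have h2 : ((n : ℝ) / p - ε * n / p) * (p - 1) = (1 - 1 / p - ε) * n + ε * n / p := by
        field_simp
        ring
      rw [h2]
      have : 0 ≤ ε * n / p := by positivity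
      linarith
    linarith
  have hSp : (S : ℝ) / p ≤ S := div_le_self hS0 (by linarith)
  have hgap : ε * n / (2 * p) ≤ x - y := by
    have h1 : S + 2 ≤ ε * n / (2 * p) := by
      rw [le_div_iff₀ (by positivity)]
      have h2 : 2 * p / ε * (S + 2) * ε ≤ n * ε := mul_le_mul_of_nonneg_right hn1 hε.le
      have h3 : 2 * p / ε * (S + 2) * ε = (S + 2) * (2 * p) := by field_simp
      linarith
    have h2 : ε * n / p = 2 * (ε * n / (2 * p)) := by field_simp
    linarith
  have hxbig : (n : ℝ) / (2 * p) ≤ x := by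
    have h1 : (S : ℝ) / p + 1 ≤ n / (2 * p) := by
      rw [le_div_iff₀ (by positivity)]
      have : ((S : ℝ) / p + 1) * (2 * p) = 2 * (S + p) := by field_simp
      linarith
    have h2 : (n : ℝ) / p = 2 * (n / (2 * p)) := by field_simp
    linarith
  have hx1 : 1 ≤ x := by
    refine le_trans ?_ hxbig
    rw [le_div_iff₀ (by positivity)]
    linarith
  have hpow : y ^ (q + 1 + 1) + ε / (4 * p ^ 2) * n ^ 2 ≤ x ^ (q + 1 + 1) := by
    have hyx : y ≤ x := by
      have : 0 ≤ ε * n / (2 * p) := by positivity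
      linarith
    have h1 : y ^ (q + 1) ≤ x ^ (q + 1) := pow_le_pow_left₀ hy0 hyx _
    have h2 : x ≤ x ^ (q + 1) := le_self_pow₀ hx1 (by omega)
    have h3 : ε / (4 * p ^ 2) * n ^ 2 = ε * n / (2 * p) * (n / (2 * p)) := by
      field_simp
      ring
    have h4 : ε * n / (2 * p) * (n / (2 * p)) ≤ (x - y) * x ^ (q + 1) :=
      mul_le_mul hgap (hxbig.trans h2) (by positivity)
        (le_trans (by positivity) hgap)
    have h5 : y ^ (q + 1) * y ≤ x ^ (q + 1) * y := mul_le_mul_of_nonneg_right h1 hy0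
    rw [h3, pow_succ, pow_succ x]
    linarith
  have hT : (turanCliques d (p - 1) (q + 1 + 1) : ℝ) ≤
      ((p - 1).choose (q + 1 + 1) : ℝ) * y ^ (q + 1 + 1) := by
    have h1 : (turanCliques d (p - 1) (q + 1 + 1) : ℝ) ≤
        ((p - 1).choose (q + 1 + 1) : ℝ) * (((d / (p - 1) : ℕ) : ℝ) + 1) ^ (q + 1 + 1) := by
      exact_mod_cast turanCliques_le d (p - 1) (q + 1 + 1)
    refine h1.trans (mul_le_mul_of_nonneg_left (pow_le_pow_left₀ (by positivity) ?_ _)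
      (Nat.cast_nonneg _))
    have h2 : ((d / (p - 1) : ℕ) : ℝ) ≤ (d : ℝ) / ((p - 1 : ℕ) : ℝ) := Nat.cast_div_le
    rw [hpc] at h2
    linarith
  have hC : (1 : ℝ) ≤ ((p - 1).choose (q + 1 + 1) : ℝ) := by
    exact_mod_cast Nat.choose_pos (by omega)
  have hg : 0 ≤ ε / (4 * p ^ 2) * (n : ℝ) ^ 2 := by positivity
  push_cast
  calc _ ≤ ((p - 1).choose (q + 1 + 1) : ℝ) * y ^ (q + 1 + 1) +
        ((p - 1).choose (q + 1 + 1) : ℝ) * (ε / (4 * p ^ 2) * n ^ 2) :=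
        add_le_add hT (le_mul_of_one_le_left hg hC)
    _ = ((p - 1).choose (q + 1 + 1) : ℝ) * (y ^ (q + 1 + 1) + ε / (4 * p ^ 2) * n ^ 2) := by ring
    _ ≤ _ := mul_le_mul_of_nonneg_left hpow (Nat.cast_nonneg _)

open Classical in
/-- The vertices whose degree is below `(1 - 1/p - ε) n`. -/
noncomputable def lowVertices {V : Type*} [Fintype V] (G : SimpleGraph V) (p : ℕ) (ε : ℝ) :
    Finset V :=
  {v | (#(nbrsIn G univ v) : ℝ) < (1 - 1 / p - ε) * Fintype.card V}

/-- If `G` has almost as many `r`-cliques as the Turán graph, few vertices have low degree. -/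
lemma eventually_card_lowVertices_le {p r : ℕ} (hr : 2 < r) (hrp : r ≤ p) {ε : ℝ} (hε : 0 < ε)
    (M : ℕ) : ∃ S : ℕ, ∀ᶠ n : ℕ in Filter.atTop, ∀ G : SimpleGraph (Fin n),
      (∀ A : Finset (Fin n), #A = p + 1 → ¬ G.IsClique (A : Set (Fin n))) →
      turanCliques n p r ≤ cliquesIn G univ r + M * n ^ 2 →
      #(lowVertices G p ε) ≤ S := by
  have hp0 : (0 : ℝ) < p := by exact_mod_cast (by omega : 0 < p)
  set g : ℝ := ε / (4 * p ^ 2) with hg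
  have hg0 : 0 < g := by positivity
  obtain ⟨S, hS⟩ := exists_nat_gt (M / g)
  rw [div_lt_iff₀ hg0] at hS
  refine ⟨S, ?_⟩
  filter_upwards [eventually_turanCliques_add_le hr hrp hε S, Filter.eventually_ge_atTop 1]
    with n hn hn1 G hfree hG
  by_contra! hlt
  obtain ⟨B, hBL, hBc⟩ := exists_subset_card_eq hlt.le
  obtain ⟨q, rfl⟩ : ∃ q, r = q + 1 := ⟨r - 1, by omega⟩
  rw [Nat.add_sub_cancel] at hn
  have hSn : S ≤ n := by
    have := card_le_univ B
    rwa [hBc, Fintype.card_fin] at this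
  have h1 := cliquesIn_le_sdiff_add G univ B q
  have h2 : cliquesIn G (univ \ B) (q + 1) ≤ turanCliques (n - S) p (q + 1) := by
    have := cliquesIn_le_turanCliques G p (univ \ B) (fun A _ => hfree A) (q + 1)
    rwa [card_sdiff_of_subset (subset_univ _), hBc, card_univ, Fintype.card_fin] at this
  have h3 := turanCliques_add_le (p := p) (r := q + 1) (l := 0) (m := n - S) (b := S) hr hrp
    (Nat.zero_le _)
  rw [Nat.sub_add_cancel hSn, zero_mul, zero_mul, add_zero, add_zero, Nat.add_sub_cancel] at h3
  set D : ℕ := (p - 1).choose q * ((n - S) / p) ^ q with hD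
  have h4 : ((∑ v ∈ B, cliquesIn G (nbrsIn G univ v) q : ℕ) : ℝ) + S * (g * n ^ 2) ≤ S * D := by
    have : ∀ v ∈ B, (cliquesIn G (nbrsIn G univ v) q : ℝ) + g * n ^ 2 ≤ D := by
      intro v hv
      have hlow := (mem_filter.1 (hBL hv)).2
      rw [Fintype.card_fin] at hlow
      have h5 := hn _ S le_rfl hlow.le
      have h6 : (cliquesIn G (nbrsIn G univ v) q : ℝ) ≤
          turanCliques #(nbrsIn G univ v) (p - 1) q := by
        exact_mod_cast cliquesIn_nbrsIn_le (by omega) hfree univ v q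
      linarith
    have h7 := sum_le_sum this
    rw [sum_add_distrib, sum_const, sum_const, hBc, nsmul_eq_mul, nsmul_eq_mul] at h7
    push_cast
    exact h7
  have h8 : (turanCliques (n - S) p (q + 1) : ℝ) + S * D ≤ cliquesIn G univ (q + 1) + M * n ^ 2 := by
    exact_mod_cast h3.trans hG
  have h9 : (cliquesIn G univ (q + 1) : ℝ) ≤ turanCliques (n - S) p (q + 1) +
      (∑ v ∈ B, cliquesIn G (nbrsIn G univ v) q : ℕ) := by
    exact_mod_cast h1.trans (Nat.add_le_add_right h2 _)
  have hn0 : (0 : ℝ) < (n : ℝ) ^ 2 := by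
    have : (0 : ℝ) < n := by exact_mod_cast hn1
    positivity
  have h10 := mul_lt_mul_of_pos_right hS hn0
  linarith

/-- A clique-free graph of large minimum degree outside `B` is colourable outside `B`
(by the Andrásfai–Erdős–Sós theorem). -/
lemma exists_coloring_of_lt_card_nbrsIn {V : Type*} [Fintype V] [DecidableEq V]
    {G : SimpleGraph V} {p : ℕ} (hfree : ∀ A : Finset V, #A = p + 1 → ¬ G.IsClique (A : Set V))
    (B : Finset V) (hdeg : ∀ v, v ∉ B →
      (3 * p - 4) * Fintype.card V / (3 * p - 1) + #B < #(nbrsIn G univ v)) :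
    ∃ c : V → ℕ, (∀ v, v ∉ B → c v < p) ∧
      ∀ u, u ∉ B → ∀ v, v ∉ B → c u = c v → ¬ G.Adj u v := by
  classical
  by_cases hB : ∃ v, v ∉ B
  swap
  · push Not at hB
    exact ⟨fun _ => 0, fun v hv => absurd (hB v) hv, fun u hu => absurd (hB u) hu⟩
  set G' := G.induce {v | v ∉ B} with hG'
  have hfree' : G'.CliqueFree (p + 1) := by
    intro A hA
    refine hfree (A.map (Function.Embedding.subtype _)) (by rw [card_map, hA.card_eq]) ?_
    intro x hx y hy hxy
    simp only [coe_map, Set.mem_image, mem_coe] at hx hy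
    obtain ⟨x', hx', rfl⟩ := hx
    obtain ⟨y', hy', rfl⟩ := hy
    exact hA.isClique hx' hy' fun h => hxy (h ▸ rfl)
  have hcol : G'.Colorable p := by
    refine SimpleGraph.colorable_of_cliqueFree_lt_minDegree hfree' ?_
    have : Nonempty {v | v ∉ B} := let ⟨v, hv⟩ := hB; ⟨⟨v, hv⟩⟩
    obtain ⟨v, hv⟩ := G'.exists_minimal_degree_vertex
    rw [hv]
    have h1 := hdeg v v.2
    have h2 : nbrsIn G univ v ⊆ (G'.neighborFinset v).map (Function.Embedding.subtype _) ∪ B := by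
      intro u hu
      rw [mem_union]
      by_cases huB : u ∈ B
      · exact Or.inr huB
      · refine Or.inl (mem_map.2 ⟨⟨u, huB⟩, ?_, rfl⟩)
        rw [SimpleGraph.mem_neighborFinset]
        exact (mem_filter.1 hu).2
    have h3 := (card_le_card h2).trans (card_union_le _ _)
    rw [card_map, SimpleGraph.card_neighborFinset_eq_degree] at h3
    have h4 : (3 * p - 4) * Fintype.card {v | v ∉ B} / (3 * p - 1) ≤
        (3 * p - 4) * Fintype.card V / (3 * p - 1) :=
      Nat.div_le_div_right (Nat.mul_le_mul_left _ (Fintype.card_subtype_le _))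
    omega
  obtain ⟨C⟩ := hcol
  refine ⟨fun v => if h : v ∉ B then C ⟨v, h⟩ else 0, fun v hv => ?_, fun u hu v hv huv hadj => ?_⟩
  · simp only [hv, not_false_eq_true, dite_true]
    exact (C ⟨v, hv⟩).2
  · simp only [hu, hv, not_false_eq_true, dite_true] at huv
    exact C.valid (v := ⟨u, hu⟩) (w := ⟨v, hv⟩) hadj (Fin.ext huv)

open Classical in
/-- The colouring of `exists_coloring_of_lt_card_nbrsIn` has large classes with few nonadjacent
pairs between them. -/
lemma eventually_exists_coloring {p : ℕ} (hp : 3 ≤ p) (S K : ℕ) :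
    ∀ᶠ n : ℕ in Filter.atTop, ∀ G : SimpleGraph (Fin n),
      (∀ A : Finset (Fin n), #A = p + 1 → ¬ G.IsClique (A : Set (Fin n))) →
      ∀ B : Finset (Fin n), #B ≤ S →
      (∀ v, v ∉ B → (1 - 1 / p - 1 / (8 * p ^ 3)) * (n : ℝ) ≤ #(nbrsIn G univ v)) →
      ∃ (c : Fin n → ℕ) (m : ℕ), (∀ v ∈ univ \ B, c v < p) ∧
        (∀ u ∈ univ \ B, ∀ v ∈ univ \ B, c u = c v → ¬ G.Adj u v) ∧
        (∀ x ∈ univ \ B, ∀ j < p, j ≠ c x →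
          #{y ∈ {w ∈ univ \ B | c w = j} | ¬ G.Adj x y} ≤ m) ∧
        ∀ j < p, (p + 1) * m + K < #{w ∈ univ \ B | c w = j} := by
  have hp3 : (3 : ℝ) ≤ p := by exact_mod_cast hp
  have hp0 : (0 : ℝ) < p := by linarith
  set ε : ℝ := 1 / (8 * p ^ 3) with hε
  have hε0 : 0 < ε := by positivity
  filter_upwards [eventually_le_natCast (8 * p ^ 2 * (S + 1)),
    eventually_le_natCast (2 * p * ((p + 2) * S + K + 1))] with n hn1 hn2 G hfree B hBS hdeg
  have hn0 : (0 : ℝ) ≤ n := Nat.cast_nonneg n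
  have hBS' : (#B : ℝ) ≤ S := by exact_mod_cast hBS
  obtain ⟨c, hc1, hc2⟩ := exists_coloring_of_lt_card_nbrsIn hfree B (by
    intro v hv
    rw [Fintype.card_fin]
    have h1 : (((3 * p - 4) * n / (3 * p - 1) : ℕ) : ℝ) ≤ (3 * p - 4) * n / (3 * p - 1) := by
      refine Nat.cast_div_le.trans ?_
      rw [Nat.cast_mul, Nat.cast_sub (by omega), Nat.cast_sub (by omega)]
      push_cast
      exact le_rfl
    have h2 : (3 * p - 4) * (n : ℝ) / (3 * p - 1) + n / (8 * p ^ 2) + ε * n ≤ (1 - 1 / p) * n := by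
      have h3 : (3 * (p : ℝ) - 4) / (3 * p - 1) + 1 / (8 * p ^ 2) + ε ≤ 1 - 1 / p := by
        have h4 : (3 * (p : ℝ) - 4) / (3 * p - 1) = 1 - 3 / (3 * p - 1) := by
          field_simp [(by linarith : (3 * (p : ℝ) - 1) ≠ 0)]
          ring
        have h5 : 3 / (3 * (p : ℝ) - 1) = 1 / p + 1 / (p * (3 * p - 1)) := by
          field_simp [(by linarith : (3 * (p : ℝ) - 1) ≠ 0)]
          ring
        have h6 : 1 / (3 * (p : ℝ) ^ 2) ≤ 1 / (p * (3 * p - 1)) :=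
          one_div_le_one_div_of_le (by nlinarith) (by nlinarith)
        have h7 : ε ≤ 1 / (8 * (p : ℝ) ^ 2) :=
          one_div_le_one_div_of_le (by positivity) (by nlinarith [sq_nonneg (p : ℝ)])
        have h8 : 1 / (3 * (p : ℝ) ^ 2) = 1 / (8 * p ^ 2) * (8 / 3) := by
          field_simp
        have h9 : 0 ≤ 1 / (8 * (p : ℝ) ^ 2) := by positivity
        linarith
      have := mul_le_mul_of_nonneg_right h3 hn0
      calc _ = ((3 * (p : ℝ) - 4) / (3 * p - 1) + 1 / (8 * p ^ 2) + ε) * n := by ring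
        _ ≤ _ := this
    have h3 : (S : ℝ) + 1 ≤ n / (8 * p ^ 2) := by
      rw [le_div_iff₀ (by positivity)]
      linarith
    have h4 := hdeg v hv
    have h5 : ((((3 * p - 4) * n / (3 * p - 1) + #B : ℕ)) : ℝ) < #(nbrsIn G univ v) := by
      rw [Nat.cast_add]
      linarith
    exact_mod_cast h5)
  have hmem : ∀ v, v ∈ univ \ B ↔ v ∉ B := by simp
  set a : ℕ → ℕ := fun j => #{w ∈ univ \ B | c w = j} with ha
  have hnon : ∀ x, x ∉ B → (#{y | ¬ G.Adj x y} : ℝ) ≤ (1 / p + ε) * n := by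
    intro x hx
    have h1 : #{y | ¬ G.Adj x y} + #(nbrsIn G univ x) = n := by
      have := card_filter_add_card_filter_not (s := (univ : Finset (Fin n))) (fun y => G.Adj x y)
      rw [card_univ, Fintype.card_fin] at this
      rw [nbrsIn]
      omega
    have h2 : (#{y | ¬ G.Adj x y} : ℝ) + #(nbrsIn G univ x) = n := by exact_mod_cast h1
    have := hdeg x hx
    linarith
  have hau : ∀ j, (a j : ℝ) ≤ (1 / p + ε) * n := by
    intro j
    rcases ({w ∈ univ \ B | c w = j} : Finset (Fin n)).eq_empty_or_nonempty with h | ⟨x, hx⟩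
    · have : a j = 0 := by simp only [ha, h, card_empty]
      rw [this, Nat.cast_zero]
      positivity
    · obtain ⟨hxB, hxj⟩ := mem_filter.1 hx
      refine le_trans ?_ (hnon x ((hmem x).1 hxB))
      refine Nat.cast_le.2 (card_le_card fun y hy => ?_)
      obtain ⟨hyB, hyj⟩ := mem_filter.1 hy
      exact mem_filter.2 ⟨mem_univ _, hc2 x ((hmem x).1 hxB) y ((hmem y).1 hyB) (hxj.trans hyj.symm)⟩
  have hsum : ∑ j ∈ range p, a j + #B = n := by
    have h1 : #(univ \ B) = ∑ j ∈ range p, a j :=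
      card_eq_sum_card_fiberwise fun v hv => mem_coe.2 (mem_range.2 (hc1 v ((hmem v).1 hv)))
    have h2 := card_sdiff_add_card_eq_card (subset_univ B)
    rw [card_univ, Fintype.card_fin] at h2
    omega
  have hal : ∀ j < p, (n : ℝ) / p - (p - 1) * ε * n - S ≤ a j := by
    intro j hj
    have h1 : (∑ i ∈ (range p).erase j, a i : ℝ) ≤ (p - 1) * ((1 / p + ε) * n) := by
      refine (sum_le_card_nsmul _ _ _ fun i _ => hau i).trans ?_
      rw [card_erase_of_mem (mem_range.2 hj), card_range, nsmul_eq_mul, Nat.cast_sub (by omega),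
        Nat.cast_one]
    have h2 : (∑ i ∈ (range p).erase j, a i : ℝ) + a j + #B = n := by
      rw [sum_erase_add (range p) (fun i => (a i : ℝ)) (mem_range.2 hj)]
      exact_mod_cast hsum
    have h3 : ((p : ℝ) - 1) * ((1 / p + ε) * n) = n - n / p + (p - 1) * ε * n := by
      field_simp
    linarith
  refine ⟨c, ⌊p * ε * n + S⌋₊, fun v hv => hc1 v ((hmem v).1 hv),
    fun u hu v hv => hc2 u ((hmem u).1 hu) v ((hmem v).1 hv), ?_, ?_⟩
  · intro x hx j hj hjx
    have hxB := (hmem x).1 hx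
    have h1 : #{y ∈ {w ∈ univ \ B | c w = j} | ¬ G.Adj x y} + a (c x) ≤ #{y | ¬ G.Adj x y} := by
      rw [ha, ← card_union_of_disjoint]
      · refine card_le_card fun y hy => mem_filter.2 ⟨mem_univ _, ?_⟩
        rcases mem_union.1 hy with hy | hy
        · exact (mem_filter.1 hy).2
        · obtain ⟨hyB, hyc⟩ := mem_filter.1 hy
          exact hc2 x hxB y ((hmem y).1 hyB) hyc.symm
      · refine disjoint_left.2 fun y hy hy' => hjx ?_
        exact (mem_filter.1 (mem_filter.1 hy).1).2.symm.trans (mem_filter.1 hy').2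
    have h2 : (#{y ∈ {w ∈ univ \ B | c w = j} | ¬ G.Adj x y} : ℝ) + a (c x) ≤
        #{y | ¬ G.Adj x y} := by exact_mod_cast h1
    refine Nat.le_floor ?_
    have h3 := hnon x hxB
    have h4 := hal (c x) (hc1 x hxB)
    have h5 : (1 / (p : ℝ) + ε) * n - (n / p - (p - 1) * ε * n - S) = p * ε * n + S := by ring
    linarith
  · intro j hj
    have h1 : ((⌊p * ε * n + S⌋₊ : ℕ) : ℝ) ≤ p * ε * n + S := Nat.floor_le (by positivity)
    have h2 := hal j hj
    have h3 : ((p : ℝ) + 1) * ⌊p * ε * n + S⌋₊ ≤ (p + 1) * (p * ε * n + S) :=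
      mul_le_mul_of_nonneg_left h1 (by linarith)
    have h4 : (p + 1) * (p * ε * n) + (p - 1) * ε * n ≤ n / (2 * p) := by
      have h5 : ((p : ℝ) + 1) * p * ε + (p - 1) * ε ≤ 1 / (2 * p) := by
        rw [le_div_iff₀ (by positivity)]
        have h6 : (((p : ℝ) + 1) * p * ε + (p - 1) * ε) * (2 * p) =
            ((p + 1) * p + (p - 1)) / (4 * p ^ 2) := by
          rw [hε]
          field_simp
          ring
        rw [h6, div_le_one (by positivity)]
        nlinarith
      have := mul_le_mul_of_nonneg_right h5 hn0
      calc _ = (((p : ℝ) + 1) * p * ε + (p - 1) * ε) * n := by ring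
        _ ≤ _ := this
        _ = _ := by ring
    have h5 : ((p : ℝ) + 2) * S + K + 1 ≤ n / (2 * p) := by
      rw [le_div_iff₀ (by positivity)]
      linarith
    have h6 : (n : ℝ) / p = 2 * (n / (2 * p)) := by field_simp
    have h7 : (((p + 1) * ⌊p * ε * n + S⌋₊ + K : ℕ) : ℝ) < a j := by
      push_cast
      linarith
    exact_mod_cast h7

lemma eventually_card_missingPairs_le {p : ℕ} (hp : 0 < p) {ε : ℝ} (hε : 0 < ε) (S S' : ℕ) :
    ∀ᶠ n : ℕ in Filter.atTop, ∀ (G : SimpleGraph (Fin n)) (B : Finset (Fin n)) (c : Fin n → ℕ),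
      #(lowVertices G p ε) ≤ S' → #B ≤ S → (∀ v ∈ univ \ B, c v < p) →
      (∀ u ∈ univ \ B, ∀ v ∈ univ \ B, c u = c v → ¬ G.Adj u v) →
      (#(missingPairs G (univ \ B) c) : ℝ) ≤ ε * n ^ 2 := by
  have hp0 : (0 : ℝ) < p := by exact_mod_cast hp
  filter_upwards [eventually_le_natCast (2 / ε * (S + S' + p + p ^ 2)), eventually_le_natCast 1]
    with n hn hn1 G B c hlow hB hcp hc
  have hn0 : (0 : ℝ) ≤ n := Nat.cast_nonneg n
  set a : ℕ → ℕ := fun i => #{x ∈ univ \ B | c x = i} with ha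
  have h1 := card_missingPairs_add_le hcp hc
  have hsum : ∑ i ∈ range p, a i = #(univ \ B) :=
    (card_eq_sum_card_fiberwise fun v hv => mem_coe.2 (mem_range.2 (hcp v hv))).symm
  have h2 : elemSum (range p) a 2 ≤ p.choose 2 * (n / p + 1) ^ 2 := by
    refine (elemSum_le_turanCliques hp a 2).trans (le_trans ?_ (turanCliques_le n p 2))
    refine turanCliques_mono hp 2 ?_
    rw [hsum]
    simpa using card_le_univ (univ \ B)
  have h3 : cliquesIn G univ 2 ≤ cliquesIn G (univ \ B) 2 + S * n := by
    refine (cliquesIn_le_sdiff_add G univ B 1).trans (Nat.add_le_add_left ?_ _)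
    refine (sum_le_card_nsmul B _ n fun v _ => (cliquesIn_one_le _ _).trans ?_).trans ?_
    · simpa using card_le_univ (nbrsIn G univ v)
    · rw [smul_eq_mul]
      exact Nat.mul_le_mul_right _ hB
  have h4 : (1 - 1 / p - ε) * (n : ℝ) ^ 2 - S' * n ≤ 2 * cliquesIn G univ 2 := by
    have h5 : ∀ v : Fin n, (1 - 1 / p - ε) * (n : ℝ) -
        (if v ∈ lowVertices G p ε then (n : ℝ) else 0) ≤ #(nbrsIn G univ v) := by
      intro v
      split_ifs with hv
      · have : (1 - 1 / p - ε) * (n : ℝ) ≤ 1 * n := by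
          refine mul_le_mul_of_nonneg_right ?_ hn0
          have : 0 ≤ 1 / (p : ℝ) := by positivity
          linarith
        have : (0 : ℝ) ≤ #(nbrsIn G univ v) := Nat.cast_nonneg _
        linarith
      · simp only [lowVertices, mem_filter, mem_univ, true_and, not_lt, Fintype.card_fin] at hv
        linarith
    have h6 := sum_le_sum fun v (_ : v ∈ univ) => h5 v
    rw [sum_sub_distrib, sum_const, card_univ, Fintype.card_fin, nsmul_eq_mul, ← sum_filter,
      filter_mem_eq_inter, univ_inter, sum_const, nsmul_eq_mul, ← Nat.cast_sum,
      sum_card_nbrsIn] at h6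
    push_cast at h6
    have h7 : (#(lowVertices G p ε) : ℝ) * n ≤ S' * n :=
      mul_le_mul_of_nonneg_right (by exact_mod_cast hlow) hn0
    linarith
  have h5 : (#(missingPairs G (univ \ B) c) : ℝ) + cliquesIn G univ 2 ≤
      p * (p - 1) / 2 * (n / p + 1) ^ 2 + S * n := by
    have h6 : #(missingPairs G (univ \ B) c) + cliquesIn G univ 2 ≤
        p.choose 2 * (n / p + 1) ^ 2 + S * n := by
      have := h1.trans h2
      omega
    have h7 : (#(missingPairs G (univ \ B) c) : ℝ) + cliquesIn G univ 2 ≤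
        (p.choose 2 : ℕ) * (((n / p : ℕ) : ℝ) + 1) ^ 2 + S * n := by exact_mod_cast h6
    refine h7.trans (add_le_add_left ?_ _)
    rw [← Nat.cast_choose_two]
    refine mul_le_mul_of_nonneg_left (pow_le_pow_left₀ (by positivity) ?_ 2) (Nat.cast_nonneg _)
    exact add_le_add_left Nat.cast_div_le 1
  have h6 : (p : ℝ) * (p - 1) / 2 * (n / p + 1) ^ 2 =
      (1 - 1 / p) * n ^ 2 / 2 + (p - 1) * n + p * (p - 1) / 2 := by
    field_simp
    ring
  have h7 : (S + S' + p + p ^ 2) * n ≤ ε * n ^ 2 / 2 := by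
    have h8 : (S + S' + p + p ^ 2 : ℝ) ≤ ε * n / 2 := by
      have h9 := mul_le_mul_of_nonneg_right hn hε.le
      have h10 : 2 / ε * (S + S' + p + p ^ 2) * ε = 2 * (S + S' + p + (p : ℝ) ^ 2) := by field_simp
      linarith
    calc _ ≤ ε * n / 2 * n := mul_le_mul_of_nonneg_right h8 hn0
      _ = _ := by ring
  have h8 : (p : ℝ) * (p - 1) / 2 ≤ p ^ 2 * n := by nlinarith [sq_nonneg (p : ℝ)]
  have h9 : (0 : ℝ) ≤ S' * n := by positivity
  nlinarith

/-- The upper bound on the size of a hypergraph without `t`-wise Berge copies of `K_{p+1}`. -/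
lemma eventually_card_le_of_not_hasBergeCopy {p r t : ℕ} (hr : 2 < r) (hrp : r ≤ p) (ht : 1 ≤ t) :
    ∀ᶠ n : ℕ in Filter.atTop, ∀ H : Finset (Finset (Fin n)), (∀ A ∈ H, #A = r) →
      ¬ HasBergeCopy H (⊤ : SimpleGraph (Fin (p + 1))) t →
      #H ≤ turanCliques n p r + (t - 1) * (n.choose 2 - turanCliques n p 2) := by
  have hp0 : (0 : ℝ) < p := by exact_mod_cast (by omega : 0 < p)
  set M := t * Fintype.card (Sym2 (Fin (p + 1))) with hM
  set ε : ℝ := 1 / (8 * p ^ 3) with hε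
  have hε0 : 0 < ε := by positivity
  set g : ℝ := ε / (4 * p ^ 2) with hg
  have hg0 : 0 < g := by positivity
  set ε' : ℝ := g / (2 * (M + 1)) with hε'
  have hε'0 : 0 < ε' := by positivity
  obtain ⟨S, hS⟩ := eventually_card_lowVertices_le hr hrp hε0 M
  obtain ⟨S', hS'⟩ := eventually_card_lowVertices_le hr hrp hε'0 M
  filter_upwards [hS, hS', eventually_exists_coloring (by omega : 3 ≤ p) S t,
    eventually_card_missingPairs_le (by omega : 0 < p) hε'0 S S',
    eventually_turanCliques_add_le hr hrp hε0 S, eventually_le_natCast (2 * M / g)]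
    with n hlow hlow' hcol hmiss hgap hn H hH hB
  set G := heavyGraph H M with hG
  have hfree : ∀ A : Finset (Fin n), #A = p + 1 → ¬ G.IsClique (A : Set (Fin n)) :=
    heavyGraph_cliqueFree (by omega) le_rfl hB
  rcases le_total #H (turanCliques n p r) with hle | hge
  · exact hle.trans (Nat.le_add_right _ _)
  have hmany : turanCliques n p r ≤ cliquesIn G univ r + M * n ^ 2 := by
    have := card_le_cliquesIn_add hH M
    rw [Fintype.card_fin] at this
    exact hge.trans this
  set B := lowVertices G p ε with hBdef
  have hBS : #B ≤ S := hlow G hfree hmany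
  obtain ⟨c, m, hcp, hc, hcm, hbig⟩ := hcol G hfree B hBS fun v hv => by
    by_contra! hlt
    exact hv (mem_filter.2 ⟨mem_univ _, by rwa [Fintype.card_fin]⟩)
  have hmiss := hmiss G B c (hlow' G hfree hmany) hBS hcp hc
  have hcod : ∀ x ∈ univ \ B, ∀ y ∈ univ \ B, x ≠ y → c x = c y → codegree H x y ≤ t - 1 :=
    fun x hx y hy hxy hcxy => Nat.le_sub_one_of_lt
      (codegree_lt_of_same_class le_rfl hB (univ \ B) c hcm
        (fun j hj => (Nat.le_add_right _ _).trans_lt (hbig j hj)) hx hy hxy hcxy (hcp x hx))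
  obtain ⟨q, rfl⟩ : ∃ q, r = q + 1 := ⟨r - 1, by omega⟩
  have hcount := card_le_of_coloring (M := M) hH B c hcp hcod
  rw [Fintype.card_fin, ← hG] at hcount
  set a : ℕ → ℕ := fun i => #{x ∈ univ \ B | c x = i} with ha
  set l := t - 1 with hl
  have hla : ∀ i ∈ range p, l ≤ a i := fun i hi => by
    have : t < a i := (Nat.le_add_left _ _).trans_lt (hbig i (mem_range.1 hi))
    omega
  have hsum : ∑ i ∈ range p, a i = #(univ \ B) :=
    (card_eq_sum_card_fiberwise fun v hv => mem_coe.2 (mem_range.2 (hcp v hv))).symm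
  set w := #(univ \ B) with hw
  have hwB : w + #B = n := by
    have := card_sdiff_add_card_eq_card (subset_univ B)
    rwa [card_univ, Fintype.card_fin] at this
  have hlw : l ≤ w / p := by
    rw [Nat.le_div_iff_mul_le (by omega), ← hsum, mul_comm]
    simpa using card_nsmul_le_sum (range p) a l hla
  have hbal := elemSum_add_le_turanCliques hr hrp hlw hla hsum
  have hE2 : elemSum (range p) a 2 ≤ turanCliques w p 2 := by
    rw [← hsum]
    exact elemSum_le_turanCliques (by omega) a 2
  have hstep := turanCliques_add_le (b := #B) hr hrp hlw
  rw [hwB, Nat.add_sub_cancel] at hstep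
  rw [Nat.add_sub_cancel] at hgap
  set D : ℕ := (p - 1).choose q * (w / p) ^ q with hD
  have hinner : l * (w.choose 2 - elemSum (range p) a 2) + elemSum (range p) a (q + 1) ≤
      turanCliques w p (q + 1) + l * (w.choose 2 - turanCliques w p 2) := by
    have hT2 : turanCliques w p 2 ≤ w.choose 2 := turanCliques_two_le (by omega)
    obtain ⟨x, hx⟩ := Nat.exists_eq_add_of_le hE2
    obtain ⟨y, hy⟩ := Nat.exists_eq_add_of_le hT2
    have h1 : w.choose 2 - elemSum (range p) a 2 = x + y := by omega
    have h2 : w.choose 2 - turanCliques w p 2 = y := by omega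
    rw [h1, h2, mul_add]
    rw [hx, mul_add] at hbal
    omega
  have houter : ∑ v ∈ B, cliquesIn G (nbrsIn G univ v) q + #B * n * M +
      #B * #(missingPairs G (univ \ B) c) * M ≤ #B * D := by
    have hsmall : (n : ℝ) * M + #(missingPairs G (univ \ B) c) * M ≤ g * n ^ 2 := by
      have hn0 : (0 : ℝ) ≤ n := Nat.cast_nonneg n
      have h1 : (n : ℝ) * M ≤ g * n ^ 2 / 2 := by
        rw [div_le_iff₀ hg0] at hn
        nlinarith
      have h2 : (#(missingPairs G (univ \ B) c) : ℝ) * M ≤ g * n ^ 2 / 2 := by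
        have h3 : ε' * (M + 1) = g / 2 := by
          rw [hε']
          field_simp
        calc _ ≤ ε' * n ^ 2 * (M + 1) :=
              mul_le_mul hmiss (by linarith) (Nat.cast_nonneg _) (by positivity)
          _ = ε' * (M + 1) * n ^ 2 := by ring
          _ = _ := by rw [h3]; ring
      linarith
    have hv : ∀ v ∈ B, (cliquesIn G (nbrsIn G univ v) q : ℝ) + g * n ^ 2 ≤ D := by
      intro v hv
      have hlt := (mem_filter.1 hv).2
      rw [Fintype.card_fin] at hlt
      have h1 := hgap _ #B hBS hlt.le
      have h2 : (cliquesIn G (nbrsIn G univ v) q : ℝ) ≤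
          turanCliques #(nbrsIn G univ v) (p - 1) q := by
        exact_mod_cast cliquesIn_nbrsIn_le (by omega) hfree univ v q
      have h3 : n - #B = w := by omega
      rw [h3] at h1
      linarith
    have hs := sum_le_sum hv
    rw [sum_add_distrib, sum_const, sum_const, nsmul_eq_mul, nsmul_eq_mul] at hs
    have h1 := mul_le_mul_of_nonneg_left hsmall (Nat.cast_nonneg (α := ℝ) #B)
    have h2 : ((∑ v ∈ B, cliquesIn G (nbrsIn G univ v) q + #B * n * M +
      #B * #(missingPairs G (univ \ B) c) * M : ℕ) : ℝ) ≤ (#B * D : ℕ) := by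
      rw [Nat.cast_add, Nat.cast_add, Nat.cast_sum]
      push_cast
      linarith
    exact_mod_cast h2
  omega

lemma HasBergeCopy.hasHeavyCopy {V α : Type*} [DecidableEq V] {H : Finset (Finset V)}
    {F : SimpleGraph α} {t : ℕ} (h : HasBergeCopy H F t) : HasHeavyCopy H F t := by
  obtain ⟨i, g, hg, -⟩ := h
  refine ⟨i, fun x y hxy => ?_⟩
  obtain ⟨h1, h2, h3⟩ := hg s(x, y) hxy
  rw [← h2]
  exact card_le_card fun A hA => mem_filter.2
    ⟨h1 hA, h3 A hA x (Sym2.mem_mk_left x y), h3 A hA y (Sym2.mem_mk_right x y)⟩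

theorem exBerge_clique_exact (r k t : ℕ) (hk : r < k) (hr : 2 < r) (ht : 1 ≤ t) :
    ∃ N : ℕ, ∀ n ≥ N,
      exBerge n r t (⊤ : SimpleGraph (Fin k)) = exHeavy n r t (⊤ : SimpleGraph (Fin k)) ∧
      exBerge n r t (⊤ : SimpleGraph (Fin k)) =
        exClique n r (⊤ : SimpleGraph (Fin k)) +
          (t - 1) * (n.choose 2 - exTuran n (⊤ : SimpleGraph (Fin k))) := by
  obtain ⟨p, rfl⟩ : ∃ p, k = p + 1 := ⟨k - 1, by omega⟩
  have hp : 0 < p := by omega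
  have hrp : r ≤ p := by omega
  obtain ⟨N, hN⟩ := Filter.eventually_atTop.1 (eventually_card_le_of_not_hasBergeCopy hr hrp ht)
  refine ⟨max N (p * t), fun n hn => ?_⟩
  have hub := hN n ((le_max_left _ _).trans hn)
  have htn : t ≤ n / p := by
    rw [Nat.le_div_iff_mul_le hp, mul_comm]
    exact (le_max_right _ _).trans hn
  obtain ⟨H, hHr, hHh, hHc⟩ := exists_heavyFree hr hrp ht htn
  rw [exClique_eq hp, exTuran_eq hp]
  have hB : IsGreatest {m | ∃ H : Finset (Finset (Fin n)), (∀ A ∈ H, A.card = r) ∧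
      ¬ HasBergeCopy H (⊤ : SimpleGraph (Fin (p + 1))) t ∧ H.card = m}
      (turanCliques n p r + (t - 1) * (n.choose 2 - turanCliques n p 2)) := by
    refine ⟨⟨H, hHr, fun h => hHh h.hasHeavyCopy, hHc⟩, ?_⟩
    rintro _ ⟨H', h1, h2, rfl⟩
    exact hub H' h1 h2
  have hH : IsGreatest {m | ∃ H : Finset (Finset (Fin n)), (∀ A ∈ H, A.card = r) ∧
      ¬ HasHeavyCopy H (⊤ : SimpleGraph (Fin (p + 1))) t ∧ H.card = m}
      (turanCliques n p r + (t - 1) * (n.choose 2 - turanCliques n p 2)) := by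
    refine ⟨⟨H, hHr, hHh, hHc⟩, ?_⟩
    rintro _ ⟨H', h1, h2, rfl⟩
    exact hub H' h1 fun h => h2 h.hasHeavyCopy
  exact ⟨hB.csSup_eq.trans hH.csSup_eq.symm, hB.csSup_eq⟩
end
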